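/- (Geometric forward-reverse Brascamp-Lieb inequality, second form.) Let linear maps U_i: E_0 → E_i and V_j: E_0 → E^j satisfy U_i U_i* = id_{E_i} and V_j V_j* = id_{E^j} for all 1≤i≤k, 1≤j≤m. Assume the map x ∈ E_0 ↦ Σ_{i=1}^k U_i x ∈ E_0 (viewing each U_i x as an element of E_i ⊆ E_0) is a bijection, and that the frame condition Σ_{i=1}^k c_i U_i* U_i = Σ_{j=1}^m d_j V_j* V_j holds. If measurable functions f_i: E_i → [0,∞) (1≤i≤k) and g_j: E^j → [0,∞) (1≤j≤m) satisfy ∏_{i=1}^k f_i(U_i x)^{c_i} ≤ ∏_{j=1}^m g_j(V_j x)^{d_j} for all x ∈ E_0, then ∏_{i=1}^k (∫_{E_i} f_i)^{c_i} ≤ ∏_{j=1}^m (∫_{E^j} g_j)^{d_j}. -/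

import Mathlib

open MeasureTheory LinearMap
open scoped RealInnerProductSpace BigOperators NNReal ENNReal

noncomputable section

namespace FRBL

/-- A positive semidefinite (self-adjoint) operator on a real inner product space. -/
def PosSemidef {G : Type*} [NormedAddCommGroup G] [InnerProductSpace ℝ G]
    (A : G →ₗ[ℝ] G) : Prop :=
  A.IsSymmetric ∧ ∀ x : G, 0 ≤ ⟪A x, x⟫

/-- A positive definite (self-adjoint) operator on a real inner product space. -/
def PosDef {G : Type*} [NormedAddCommGroup G] [InnerProductSpace ℝ G]
    (A : G →ₗ[ℝ] G) : Prop :=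
  A.IsSymmetric ∧ ∀ x : G, x ≠ 0 → 0 < ⟪A x, x⟫

variable {k m : ℕ}
  (E : Fin k → Type*) (F : Fin m → Type*)
  [∀ i, NormedAddCommGroup (E i)] [∀ i, InnerProductSpace ℝ (E i)]
  [∀ i, FiniteDimensional ℝ (E i)]
  [∀ i, MeasurableSpace (E i)] [∀ i, BorelSpace (E i)]
  [∀ j, NormedAddCommGroup (F j)] [∀ j, InnerProductSpace ℝ (F j)]
  [∀ j, FiniteDimensional ℝ (F j)]
  [∀ j, MeasurableSpace (F j)] [∀ j, BorelSpace (F j)]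
  (c : Fin k → ℝ) (d : Fin m → ℝ)
  (B : ∀ i j, E i →ₗ[ℝ] F j)

/-- The pointwise domination hypothesis of the forward-reverse Brascamp-Lieb inequality. -/
def Hyp (f : ∀ i, E i → ℝ≥0) (g : ∀ j, F j → ℝ≥0) : Prop :=
  ∀ x : ∀ i, E i,
    (∏ i, f i (x i) ^ c i) ≤ ∏ j, g j (∑ i, c i • B i j (x i)) ^ d j

/-- `D₀` is an admissible constant for the forward-reverse Brascamp-Lieb inequality. -/
def IsBound (D₀ : ℝ) : Prop :=
  ∀ (f : ∀ i, E i → ℝ≥0) (g : ∀ j, F j → ℝ≥0),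
    (∀ i, Measurable (f i)) → (∀ j, Measurable (g j)) →
    Hyp E F c d B f g →
    (∏ i, (∫⁻ x, (f i x : ℝ≥0∞)) ^ c i) ≤
      ENNReal.ofReal (Real.exp D₀) * ∏ j, (∫⁻ y, (g j y : ℝ≥0∞)) ^ d j

/-- The best constant `D(c,d,B)` in the forward-reverse Brascamp-Lieb inequality. -/
def D : EReal :=
  sInf {x : EReal | ∃ D₀ : ℝ, x = (D₀ : EReal) ∧ IsBound E F c d B D₀}

/-- The gaussian constraint `Λ_c B* U_d B Λ_c ≤ V_c`, written via quadratic forms. -/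
def GaussCon (V : ∀ i, E i →ₗ[ℝ] E i) (U : ∀ j, F j →ₗ[ℝ] F j) : Prop :=
  ∀ x : ∀ i, E i,
    (∑ j, d j * ⟪U j (∑ i, c i • B i j (x i)), ∑ i, c i • B i j (x i)⟫) ≤
      ∑ i, c i * ⟪V i (x i), x i⟫

/-- The objective functional in the definition of the gaussian constant. -/
def gaussObj (V : ∀ i, E i →ₗ[ℝ] E i) (U : ∀ j, F j →ₗ[ℝ] F j) : ℝ :=
  (∑ j, d j * Real.log (LinearMap.det (U j)) -
    ∑ i, c i * Real.log (LinearMap.det (V i))) / 2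

/-- The gaussian best constant `D_g(c,d,B)`. -/
def Dg : EReal :=
  sSup {x : EReal | ∃ (V : ∀ i, E i →ₗ[ℝ] E i) (U : ∀ j, F j →ₗ[ℝ] F j),
    (∀ i, PosDef (V i)) ∧ (∀ j, PosDef (U j)) ∧ GaussCon E F c d B V U ∧
    x = (gaussObj E F c d V U : EReal)}

/-- The datum `(c,d,B)` is gaussian-extremizable: the supremum defining `D_g` is
finite and attained. -/
def GaussExt : Prop :=
  ∃ (V : ∀ i, E i →ₗ[ℝ] E i) (U : ∀ j, F j →ₗ[ℝ] F j),
    (∀ i, PosDef (V i)) ∧ (∀ j, PosDef (U j)) ∧ GaussCon E F c d B V U ∧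
    Dg E F c d B = (gaussObj E F c d V U : EReal)

/-- The canonical linear equivalence between `E₀ = ⊕ᵢ Eᵢ` (as `PiLp 2`) and the pi type. -/
def toPi : PiLp 2 E ≃ₗ[ℝ] ∀ i, E i := WithLp.linearEquiv 2 ℝ (∀ i, E i)

/-- Orthogonal projection `π_{E_i} : E₀ → E_i`. -/
def projL (i : Fin k) : PiLp 2 E →ₗ[ℝ] E i := (LinearMap.proj i).comp (toPi E).toLinearMap

/-- The embedding `E_i → E₀`. -/
def singleL (i : Fin k) : E i →ₗ[ℝ] PiLp 2 E :=
  (toPi E).symm.toLinearMap.comp (LinearMap.single ℝ E i)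

/-- The map `B_j : E₀ → E^j`, `x ↦ ∑ᵢ B_{ij} π_{E_i} x`. -/
def Bop (j : Fin m) : PiLp 2 E →ₗ[ℝ] F j := ∑ i, (B i j).comp (projL E i)

/-- `Λ_c = ⊕ᵢ cᵢ id_{E_i}` as an operator on `E₀`. -/
def Lam : PiLp 2 E →ₗ[ℝ] PiLp 2 E := ∑ i, c i • (singleL E i).comp (projL E i)

/-- The set `Π(A_1, …, A_k)` of positive semidefinite "couplings". -/
def Coupling (A : ∀ i, E i →ₗ[ℝ] E i) : Set (PiLp 2 E →ₗ[ℝ] PiLp 2 E) :=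
  {P | PosSemidef P ∧ ∀ (i : Fin k) (v : E i),
    ⟪P (singleL E i v), singleL E i v⟫ = ⟪A i v, v⟫}

/-- The scaling condition `∑ᵢ cᵢ dim Eᵢ = ∑ⱼ dⱼ dim E^j`. -/
def ScalingCond : Prop :=
  ∑ i, c i * (Module.finrank ℝ (E i) : ℝ) = ∑ j, d j * (Module.finrank ℝ (F j) : ℝ)

/-- A subspace `T ⊆ E₀` is of product form, i.e. `T = ⊕ᵢ π_{E_i} T`. -/
def ProductForm (T : Submodule ℝ (PiLp 2 E)) : Prop :=
  ∀ x ∈ T, ∀ i, singleL E i (projL E i x) ∈ T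

/-- The dimension condition over product-form subspaces. -/
def DimCond : Prop :=
  ∀ T : Submodule ℝ (PiLp 2 E), ProductForm E T →
    (∑ i, c i * (Module.finrank ℝ (T.map (projL E i)) : ℝ)) ≤
      ∑ j, d j * (Module.finrank ℝ (T.map (Bop E F B j)) : ℝ)

/-- A critical subspace. -/
def IsCritical (T : Submodule ℝ (PiLp 2 E)) : Prop :=
  T ≠ ⊥ ∧ T ≠ ⊤ ∧ ProductForm E T ∧
    ∑ i, c i * (Module.finrank ℝ (T.map (projL E i)) : ℝ) =
      ∑ j, d j * (Module.finrank ℝ (T.map (Bop E F B j)) : ℝ)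

/-- The datum is simple if it has no critical subspace. -/
def Simple : Prop := ∀ T : Submodule ℝ (PiLp 2 E), ¬ IsCritical E F c d B T

end FRBL

namespace FRBL

/-- `log det` with value `−∞` on operators with non-positive determinant
(in particular on singular positive-semidefinite operators). -/
def elogdet {G : Type*} [AddCommGroup G] [Module ℝ G] (A : G →ₗ[ℝ] G) : EReal :=
  if 0 < LinearMap.det A then ((Real.log (LinearMap.det A) : ℝ) : EReal) else ⊥

variable {k m : ℕ}
  (E : Fin k → Type*) (F : Fin m → Type*)
  [∀ i, NormedAddCommGroup (E i)] [∀ i, InnerProductSpace ℝ (E i)]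
  [∀ i, FiniteDimensional ℝ (E i)]
  [∀ j, NormedAddCommGroup (F j)] [∀ j, InnerProductSpace ℝ (F j)]
  [∀ j, FiniteDimensional ℝ (F j)]
  (c : Fin k → ℝ) (d : Fin m → ℝ)
  (B : ∀ i j, E i →ₗ[ℝ] F j)

/-- The map `Q_j := B_j Λ_c : E₀ → E^j`. -/
def BLam (j : Fin m) : PiLp 2 E →ₗ[ℝ] F j := (Bop E F B j).comp (Lam E c)

/-- The optimality condition of Theorem 2 (structure of gaussian extremizers):
each `B_j Λ_c Π Λ_c B_j*` is invertible and
`∑ⱼ dⱼ Λ_c B_j* (B_j Λ_c Π Λ_c B_j*)⁻¹ B_j Λ_c ≤ V_c` in the quadratic-form sense. -/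
def ExtCond (V : ∀ i, E i →ₗ[ℝ] E i) (P : PiLp 2 E →ₗ[ℝ] PiLp 2 E) : Prop :=
  (∀ j, IsUnit ((BLam E F c B j) ∘ₗ P ∘ₗ LinearMap.adjoint (BLam E F c B j))) ∧
  ∀ x : PiLp 2 E,
    (∑ j, d j * ⟪Ring.inverse ((BLam E F c B j) ∘ₗ P ∘ₗ LinearMap.adjoint (BLam E F c B j))
        (BLam E F c B j x), BLam E F c B j x⟫) ≤
      ∑ i, c i * ⟪V i (projL E i x), projL E i x⟫

/-- A geometric datum. -/
def Geometric : Prop :=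
  ScalingCond E F c d ∧
  ∃ S ∈ Coupling E (fun i => (LinearMap.id : E i →ₗ[ℝ] E i)),
    (∀ j, (BLam E F c B j) ∘ₗ S ∘ₗ LinearMap.adjoint (BLam E F c B j) = LinearMap.id) ∧
    ∀ x : PiLp 2 E, (∑ j, d j * ⟪BLam E F c B j x, BLam E F c B j x⟫) ≤ ⟪Lam E c x, x⟫

/-- Equivalence of data: `B'_j = C_j⁻¹ B_j C⁻¹` for invertible `C, C_j`. -/
def EquivData (B' : ∀ i j, E i →ₗ[ℝ] F j) : Prop :=
  ∃ (C : PiLp 2 E ≃ₗ[ℝ] PiLp 2 E) (Cj : ∀ j, F j ≃ₗ[ℝ] F j),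
    ∀ j, Bop E F B' j =
      ((Cj j).symm.toLinearMap ∘ₗ Bop E F B j) ∘ₗ C.symm.toLinearMap

/-- `V_c = ⊕ᵢ cᵢ Vᵢ` as an operator on `E₀`. -/
def blockDiag (V : ∀ i, E i →ₗ[ℝ] E i) : PiLp 2 E →ₗ[ℝ] PiLp 2 E :=
  ∑ i, c i • ((singleL E i) ∘ₗ (V i)) ∘ₗ (projL E i)

/-- `Θ = V_c − ∑ⱼ dⱼ Λ_c B_j* U_j B_j Λ_c`. -/
def Theta (V : ∀ i, E i →ₗ[ℝ] E i) (U : ∀ j, F j →ₗ[ℝ] F j) :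
    PiLp 2 E →ₗ[ℝ] PiLp 2 E :=
  blockDiag E c V -
    ∑ j, d j • (LinearMap.adjoint (BLam E F c B j) ∘ₗ (U j)) ∘ₗ (BLam E F c B j)

end FRBL

namespace FRBL

/-- Borel structure on submodules (inherited from the ambient space). -/
instance subBorel {G : Type*} [AddCommGroup G] [Module ℝ G] [TopologicalSpace G]
    [MeasurableSpace G] [BorelSpace G] (T : Submodule ℝ G) : BorelSpace ↥T :=
  Subtype.borelSpace (T : Set G)

/-- The maximal dimension of a subspace on which the self-adjoint operator `Q` is positive
definite; by Sylvester's law of inertia this is the number of positive eigenvalues of `Q`,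
counted with multiplicity. -/
def posIndex {H : Type*} [NormedAddCommGroup H] [InnerProductSpace ℝ H]
    (Q : H →ₗ[ℝ] H) : ℕ :=
  sSup {r : ℕ | ∃ W : Submodule ℝ H,
    (∀ x ∈ W, x ≠ 0 → 0 < ⟪Q x, x⟫) ∧ Module.finrank ℝ W = r}

/-- The standard gaussian probability measure on a Euclidean space. -/
def stdGaussian (G : Type*) [NormedAddCommGroup G] [InnerProductSpace ℝ G]
    [FiniteDimensional ℝ G] [MeasurableSpace G] [BorelSpace G] :
    Measure G :=
  volume.withDensity fun x =>
    ENNReal.ofReal ((2 * Real.pi) ^ (-(Module.finrank ℝ G : ℝ) / 2) *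
      Real.exp (-‖x‖ ^ 2 / 2))

/-- `K_s = (|s|^{1/s} |s'|^{1/s'})^{1/2}`. -/
def Kconst (s s' : ℝ) : ℝ := Real.sqrt (|s| ^ (1 / s) * |s'| ^ (1 / s'))

variable {k m : ℕ}
  (E : Fin k → Type*) (F : Fin m → Type*)
  [∀ i, NormedAddCommGroup (E i)] [∀ i, InnerProductSpace ℝ (E i)]
  [∀ i, FiniteDimensional ℝ (E i)]
  [∀ j, NormedAddCommGroup (F j)] [∀ j, InnerProductSpace ℝ (F j)]
  [∀ j, FiniteDimensional ℝ (F j)]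
  (c : Fin k → ℝ) (d : Fin m → ℝ)
  (B : ∀ i j, E i →ₗ[ℝ] F j)

/-- The objective functional `∑ⱼ dⱼ log det Uⱼ − ∑ᵢ cᵢ log det Vᵢ`. -/
def objective (V : ∀ i, E i →ₗ[ℝ] E i) (U : ∀ j, F j →ₗ[ℝ] F j) : ℝ :=
  ∑ j, d j * Real.log (LinearMap.det (U j)) - ∑ i, c i * Real.log (LinearMap.det (V i))

/-- Feasibility for the optimization problem defining `D_g`: positive definiteness
together with the constraint `Θ ≥ 0`. -/
def Admissible (V : ∀ i, E i →ₗ[ℝ] E i) (U : ∀ j, F j →ₗ[ℝ] F j) : Prop :=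
  (∀ i, PosDef (V i)) ∧ (∀ j, PosDef (U j)) ∧ PosSemidef (Theta E F c d B V U)

/-- Global maximality in the optimization problem defining `D_g`. -/
def IsGlobalMax (V : ∀ i, E i →ₗ[ℝ] E i) (U : ∀ j, F j →ₗ[ℝ] F j) : Prop :=
  Admissible E F c d B V U ∧
    ∀ V' U', Admissible E F c d B V' U' →
      objective E F c d V' U' ≤ objective E F c d V U

/-- Local maximality in the optimization problem defining `D_g`. -/
def IsLocalMax (V : ∀ i, E i →ₗ[ℝ] E i) (U : ∀ j, F j →ₗ[ℝ] F j) : Prop :=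
  Admissible E F c d B V U ∧
    ∃ ε : ℝ, 0 < ε ∧
      ∀ V' U', Admissible E F c d B V' U' →
        (∀ i, ‖LinearMap.toContinuousLinearMap (V' i - V i)‖ < ε) →
        (∀ j, ‖LinearMap.toContinuousLinearMap (U' j - U j)‖ < ε) →
        objective E F c d V' U' ≤ objective E F c d V U

end FRBL

namespace BrascampLieb

section

open ProbabilityTheory Filter Topology

section Coisometry

variable {G H : Type*} [NormedAddCommGroup G] [InnerProductSpace ℝ G] [FiniteDimensional ℝ G]
  [NormedAddCommGroup H] [InnerProductSpace ℝ H] [FiniteDimensional ℝ H]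

lemma sum_inner_map_sq {ι : Type*} [Fintype ι] (b : OrthonormalBasis ι ℝ H)
    (U : H →ₗ[ℝ] G) (hU : U ∘ₗ LinearMap.adjoint U = LinearMap.id) (w : G) :
    ∑ i, ⟪w, U (b i)⟫ ^ 2 = ‖w‖ ^ 2 := by
  have h1 : ∀ i, ⟪w, U (b i)⟫ = ⟪LinearMap.adjoint U w, b i⟫ := fun i => by
    rw [LinearMap.adjoint_inner_left]
  simp_rw [h1, b.sum_sq_inner_left]
  rw [← real_inner_self_eq_norm_sq, ← real_inner_self_eq_norm_sq, LinearMap.adjoint_inner_left]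
  have := LinearMap.congr_fun hU w
  simp only [LinearMap.comp_apply, LinearMap.id_apply] at this
  rw [this]

lemma sum_norm_map_sq {ι : Type*} [Fintype ι] (b : OrthonormalBasis ι ℝ H)
    (U : H →ₗ[ℝ] G) (hU : U ∘ₗ LinearMap.adjoint U = LinearMap.id) :
    ∑ i, ‖U (b i)‖ ^ 2 = Module.finrank ℝ G := by
  have h1 : ∀ i, ‖U (b i)‖ ^ 2 = ∑ j, ⟪stdOrthonormalBasis ℝ G j, U (b i)⟫ ^ 2 := fun i =>
    ((stdOrthonormalBasis ℝ G).sum_sq_inner_right _).symm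
  simp_rw [h1]
  rw [Finset.sum_comm]
  simp_rw [sum_inner_map_sq b U hU]
  simp

end Coisometry

section HeatFlow

variable {G : Type*} [NormedAddCommGroup G] [InnerProductSpace ℝ G] [FiniteDimensional ℝ G]
  [MeasurableSpace G] [BorelSpace G]

/-- The unnormalised gaussian average `∫ f (x + √t y) exp (-‖y‖² / 2) dy`, that is, the heat flow
started from `f`, up to a constant factor. -/
def heatFlow (f : G → ℝ) (t : ℝ) (x : G) : ℝ :=
  ∫ y, f (x + √t • y) * Real.exp (-‖y‖ ^ 2 / 2)

lemma integrable_exp_neg_mul_sq_norm_add {b : ℝ} (hb : 0 < b) (c : ℝ) (w : G) :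
    Integrable (fun v : G => Real.exp (-b * ‖v‖ ^ 2 + c * ⟪w, v⟫)) := by
  have h := (GaussianFourier.integrable_cexp_neg_mul_sq_norm_add
    (V := G) (b := (b : ℂ)) (by simpa using hb) (c : ℂ) w).re
  refine h.congr (ae_of_all _ fun v => ?_)
  have : (-(b : ℂ) * (‖v‖ : ℂ) ^ 2 + (c : ℂ) * ((⟪w, v⟫ : ℝ) : ℂ))
      = ((-b * ‖v‖ ^ 2 + c * ⟪w, v⟫ : ℝ) : ℂ) := by push_cast; ring
  simp only [this]
  exact Complex.exp_ofReal_re _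

lemma integrable_exp_neg_mul_sq_norm {b : ℝ} (hb : 0 < b) :
    Integrable (fun v : G => Real.exp (-b * ‖v‖ ^ 2)) := by
  simpa using integrable_exp_neg_mul_sq_norm_add hb 0 (0 : G)

lemma integrable_bdd_mul {f h : G → ℝ} {M : ℝ} (hf : Measurable f) (h0 : ∀ x, 0 ≤ f x)
    (hM : ∀ x, f x ≤ M) (hh : Integrable h) : Integrable (fun x => f x * h x) :=
  hh.bdd_mul (c := M) hf.aestronglyMeasurable
    (ae_of_all _ fun x => by rw [Real.norm_of_nonneg (h0 x)]; exact hM x)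

lemma heatFlow_eq_kernel (f : G → ℝ) {t : ℝ} (ht : 0 < t) (x : G) :
    heatFlow f t x = (√t ^ Module.finrank ℝ G)⁻¹ *
      ∫ z, f z * Real.exp (-‖z - x‖ ^ 2 / (2 * t)) := by
  have hs : 0 < √t := Real.sqrt_pos.2 ht
  have h1 := Measure.integral_comp_smul (volume : Measure G)
    (fun z => f (x + z) * Real.exp (-‖z‖ ^ 2 / (2 * t))) (√t)
  have h2 : ∫ z, f (x + z) * Real.exp (-‖z‖ ^ 2 / (2 * t)) =
      ∫ z, f z * Real.exp (-‖z - x‖ ^ 2 / (2 * t)) := by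
    simpa using integral_add_left_eq_self (μ := (volume : Measure G))
      (fun z => f z * Real.exp (-‖z - x‖ ^ 2 / (2 * t))) x
  rw [h2, smul_eq_mul, abs_of_pos (by positivity)] at h1
  rw [← h1, heatFlow]
  congr 1
  ext y
  congr 2
  rw [norm_smul, mul_pow, Real.norm_of_nonneg hs.le, Real.sq_sqrt ht.le]
  field_simp

lemma integral_withDensity_ofReal {h φ : G → ℝ} (hh : Measurable h) (h0 : ∀ x, 0 ≤ h x) :
    ∫ x, φ x ∂(volume.withDensity fun x => ENNReal.ofReal (h x)) = ∫ x, h x * φ x := by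
  rw [integral_withDensity_eq_integral_toReal_smul hh.ennreal_ofReal (ae_of_all _ fun _ => by simp)]
  simp [ENNReal.toReal_ofReal (h0 _)]

lemma integrable_withDensity_ofReal {h φ : G → ℝ} (hh : Measurable h) (h0 : ∀ x, 0 ≤ h x) :
    Integrable φ (volume.withDensity fun x => ENNReal.ofReal (h x)) ↔
      Integrable (fun x => h x * φ x) := by
  rw [integrable_withDensity_iff_integrable_smul' hh.ennreal_ofReal (ae_of_all _ fun _ => by simp)]
  simp [ENNReal.toReal_ofReal (h0 _)]

lemma integral_mul_pos {f h : G → ℝ} (h0 : ∀ x, 0 ≤ f x)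
    (hpos : 0 < volume (Function.support f)) (hh : ∀ x, 0 < h x)
    (hInt : Integrable fun x => f x * h x) : 0 < ∫ x, f x * h x := by
  rw [integral_pos_iff_support_of_nonneg (fun x => mul_nonneg (h0 x) (hh x).le) hInt]
  have : (Function.support fun x => f x * h x) = Function.support f := by
    ext x; simp [(hh x).ne']
  rwa [this]

lemma heatFlow_pos {f : G → ℝ} {M : ℝ} (hf : Measurable f) (h0 : ∀ x, 0 ≤ f x)
    (hM : ∀ x, f x ≤ M) (hpos : 0 < volume (Function.support f)) {t : ℝ} (ht : 0 < t) (x : G) :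
    0 < heatFlow f t x := by
  rw [heatFlow_eq_kernel f ht]
  have hs : 0 < √t := Real.sqrt_pos.2 ht
  refine mul_pos (by positivity) (integral_mul_pos h0 hpos (fun _ => Real.exp_pos _) ?_)
  refine integrable_bdd_mul hf h0 hM ?_
  refine (((integrable_exp_neg_mul_sq_norm (G := G) (b := 1 / (2 * t)) (by positivity)).comp_sub_right
    x)).congr (ae_of_all _ fun z => ?_)
  simp only
  congr 1
  ring

lemma hasDerivAt_log_heatFlow_time {f : G → ℝ} {M : ℝ} (hf : Measurable f) (h0 : ∀ x, 0 ≤ f x)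
    (hM : ∀ x, f x ≤ M) (hpos : 0 < volume (Function.support f)) {t : ℝ} (ht : 0 < t) (x : G) :
    HasDerivAt (fun s => Real.log (heatFlow f s x))
      (((∫ z, f z * Real.exp (-‖z - x‖ ^ 2 / (2 * t)) * ‖z - x‖ ^ 2) /
        (∫ z, f z * Real.exp (-‖z - x‖ ^ 2 / (2 * t))) / t ^ 2 - Module.finrank ℝ G / t) / 2) t := by
  set ν : Measure G := volume.withDensity fun z => ENNReal.ofReal (f z) with hν
  set X : G → ℝ := fun z => -‖z - x‖ ^ 2 / 2 with hX
  have hexp : ∀ a : ℝ, 0 < a → Integrable (fun z => Real.exp (a * X z)) ν := fun a ha => by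
    rw [hν, integrable_withDensity_ofReal hf h0]
    refine integrable_bdd_mul hf h0 hM ?_
    refine (((integrable_exp_neg_mul_sq_norm (G := G) (b := a / 2) (by positivity)).comp_sub_right
      x)).congr (ae_of_all _ fun z => ?_)
    simp only [hX]
    congr 1
    ring
  have hInt : t⁻¹ ∈ interior (integrableExpSet X ν) := by
    rw [mem_interior_iff_mem_nhds]
    filter_upwards [lt_mem_nhds (inv_pos.2 ht)] with a ha using hexp a ha
  have hmgf : ∀ s : ℝ, mgf X ν s⁻¹ = ∫ z, f z * Real.exp (-‖z - x‖ ^ 2 / (2 * s)) := fun s => by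
    rw [mgf, hν, integral_withDensity_ofReal hf h0]
    congr 1; ext z; congr 2; simp only [hX]; ring
  have hpos' : ∀ s : ℝ, 0 < s → 0 < mgf X ν s⁻¹ := fun s hs => by
    rw [hmgf]
    refine integral_mul_pos h0 hpos (fun _ => Real.exp_pos _) ?_
    have := hexp s⁻¹ (inv_pos.2 hs)
    rw [hν, integrable_withDensity_ofReal hf h0] at this
    refine this.congr (ae_of_all _ fun z => ?_)
    simp only [hX]; congr 2; ring
  have hev : (fun s => Real.log (heatFlow f s x)) =ᶠ[𝓝 t]
      fun s => -(Module.finrank ℝ G / 2 * Real.log s) + Real.log (mgf X ν s⁻¹) := by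
    filter_upwards [lt_mem_nhds ht] with s hs
    have hs' : 0 < √s := Real.sqrt_pos.2 hs
    rw [heatFlow_eq_kernel f hs, ← hmgf, Real.log_mul (by positivity) (hpos' s hs).ne',
      Real.log_inv, Real.log_pow, Real.log_sqrt hs.le]
    ring
  refine HasDerivAt.congr_of_eventuallyEq ?_ hev
  have hd := (hasDerivAt_mgf hInt).comp t (hasDerivAt_inv ht.ne')
  have hd2 := ((Real.hasDerivAt_log ht.ne').const_mul (Module.finrank ℝ G / 2 : ℝ)).neg.add
    (hd.log (hpos' t ht).ne')
  refine hd2.congr_deriv ?_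
  have : ∫ z, X z * Real.exp (t⁻¹ * X z) ∂ν =
      -(∫ z, f z * Real.exp (-‖z - x‖ ^ 2 / (2 * t)) * ‖z - x‖ ^ 2) / 2 := by
    rw [hν, integral_withDensity_ofReal hf h0, neg_div, ← integral_div, ← integral_neg]
    congr 1; ext z
    have : t⁻¹ * X z = -‖z - x‖ ^ 2 / (2 * t) := by simp only [hX]; ring
    rw [this]; simp only [hX]; ring
  rw [this, Function.comp_apply, hmgf]
  ring

lemma hasDerivAt_log_heatFlow_space {f : G → ℝ} {M : ℝ} (hf : Measurable f) (h0 : ∀ x, 0 ≤ f x)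
    (hM : ∀ x, f x ≤ M) (hpos : 0 < volume (Function.support f)) {t : ℝ} (ht : 0 < t) (x v : G) :
    ∃ φ' : ℝ → ℝ, (∀ r, HasDerivAt (fun r : ℝ => Real.log (heatFlow f t (x + r • v))) (φ' r) r) ∧
      φ' 0 = (∫ z, f z * Real.exp (-‖z - x‖ ^ 2 / (2 * t)) * ⟪z - x, v⟫) /
        (∫ z, f z * Real.exp (-‖z - x‖ ^ 2 / (2 * t))) / t ∧
      HasDerivAt φ' ((∫ z, f z * Real.exp (-‖z - x‖ ^ 2 / (2 * t)) * ⟪z - x, v⟫ ^ 2) /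
        (∫ z, f z * Real.exp (-‖z - x‖ ^ 2 / (2 * t))) / t ^ 2 - ‖v‖ ^ 2 / t -
        ((∫ z, f z * Real.exp (-‖z - x‖ ^ 2 / (2 * t)) * ⟪z - x, v⟫) /
        (∫ z, f z * Real.exp (-‖z - x‖ ^ 2 / (2 * t))) / t) ^ 2) 0 := by
  set K : G → ℝ := fun z => f z * Real.exp (-‖z - x‖ ^ 2 / (2 * t)) with hK
  have hKm : Measurable K := hf.mul (by fun_prop)
  have hK0 : ∀ z, 0 ≤ K z := fun z => mul_nonneg (h0 z) (Real.exp_pos _).le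
  set ν : Measure G := volume.withDensity fun z => ENNReal.ofReal (K z) with hν
  set X : G → ℝ := fun z => ⟪z - x, v⟫ / t with hX
  have hexp : ∀ a : ℝ, Integrable (fun z => Real.exp (a * X z)) ν := fun a => by
    rw [hν, integrable_withDensity_ofReal hKm hK0]
    simp only [hK, mul_assoc]
    refine integrable_bdd_mul hf h0 hM ?_
    refine (((integrable_exp_neg_mul_sq_norm_add (G := G) (b := 1 / (2 * t)) (by positivity)
      (a / t) v).comp_sub_right x)).congr (ae_of_all _ fun z => ?_)
    simp only [hX, ← Real.exp_add]
    rw [real_inner_comm]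
    congr 1
    ring
  have huniv : integrableExpSet X ν = Set.univ := Set.eq_univ_of_forall hexp
  have hInt : ∀ r, r ∈ interior (integrableExpSet X ν) := fun r => by simp [huniv]
  have hmgf : ∀ r : ℝ, mgf X ν r = ∫ z, f z * (Real.exp (-‖z - x‖ ^ 2 / (2 * t)) *
      Real.exp (r * X z)) := fun r => by
    rw [mgf, hν, integral_withDensity_ofReal hKm hK0]
    simp only [hK, mul_assoc]
  have hmpos : ∀ r : ℝ, 0 < mgf X ν r := fun r => by
    rw [hmgf]
    refine integral_mul_pos h0 hpos (fun _ => by positivity) ?_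
    have := hexp r
    rw [hν, integrable_withDensity_ofReal hKm hK0] at this
    simpa only [hK, mul_assoc] using this
  have hflow : ∀ r : ℝ, heatFlow f t (x + r • v) = (√t ^ Module.finrank ℝ G)⁻¹ *
      (Real.exp (-(‖v‖ ^ 2 / (2 * t) * r ^ 2)) * mgf X ν r) := fun r => by
    rw [heatFlow_eq_kernel f ht, hmgf, ← integral_const_mul (Real.exp _)]
    congr 1
    refine integral_congr_ae (ae_of_all _ fun z => ?_)
    beta_reduce
    rw [mul_left_comm, ← Real.exp_add, ← Real.exp_add]
    congr 2
    have : z - (x + r • v) = (z - x) - r • v := by abel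
    rw [this, norm_sub_sq_real, inner_smul_right, norm_smul, mul_pow, Real.norm_eq_abs, sq_abs]
    simp only [hX]
    field_simp
    ring
  have hs : 0 < √t := Real.sqrt_pos.2 ht
  have hlog : (fun r : ℝ => Real.log (heatFlow f t (x + r • v))) = fun r =>
      Real.log ((√t ^ Module.finrank ℝ G)⁻¹) + (-(‖v‖ ^ 2 / (2 * t) * r ^ 2) + cgf X ν r) := by
    ext r
    rw [hflow, Real.log_mul (by positivity) (mul_pos (Real.exp_pos _) (hmpos r)).ne',
      Real.log_mul (Real.exp_pos _).ne' (hmpos r).ne', Real.log_exp, cgf]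
  have hν0 : mgf X ν 0 = ∫ z, K z := by
    rw [mgf, hν, integral_withDensity_ofReal hKm hK0]
    simp
  have hdc : deriv (cgf X ν) 0 = (∫ z, K z * ⟪z - x, v⟫) / (∫ z, K z) / t := by
    have h : ∀ z, K z * (X z * Real.exp (0 * X z)) = K z * ⟪z - x, v⟫ / t := fun z => by
      simp only [hX, zero_mul, Real.exp_zero]
      ring
    rw [deriv_cgf (hInt 0), hν0, hν, integral_withDensity_ofReal hKm hK0]
    simp_rw [h]
    rw [integral_div, div_right_comm]
  have hdc2 : iteratedDeriv 2 (cgf X ν) 0 = (∫ z, K z * ⟪z - x, v⟫ ^ 2) / (∫ z, K z) / t ^ 2 -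
      ((∫ z, K z * ⟪z - x, v⟫) / (∫ z, K z) / t) ^ 2 := by
    have h : ∀ z, K z * (X z ^ 2 * Real.exp (0 * X z)) = K z * ⟪z - x, v⟫ ^ 2 / t ^ 2 := fun z => by
      simp only [hX, zero_mul, Real.exp_zero]
      ring
    rw [iteratedDeriv_two_cgf (hInt 0), hν0, hdc, hν, integral_withDensity_ofReal hKm hK0]
    simp_rw [h]
    rw [integral_div, div_right_comm]
  have hsq : ∀ r : ℝ, HasDerivAt (fun r : ℝ => -(‖v‖ ^ 2 / (2 * t) * r ^ 2))
      (-(‖v‖ ^ 2 / t * r)) r := fun r => by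
    refine (((hasDerivAt_pow 2 r).const_mul (‖v‖ ^ 2 / (2 * t))).neg).congr_deriv ?_
    field_simp
    simp
  refine ⟨fun r => -(‖v‖ ^ 2 / t * r) + deriv (cgf X ν) r, fun r => ?_, ?_, ?_⟩
  · rw [hlog]
    exact ((hsq r).add (analyticAt_cgf (hInt r)).differentiableAt.hasDerivAt).const_add _
  · simp only [mul_zero, neg_zero, zero_add]
    exact hdc
  · have h1 : HasDerivAt (fun r : ℝ => -(‖v‖ ^ 2 / t * r)) (-(‖v‖ ^ 2 / t)) 0 := by
      exact ((hasDerivAt_id (0 : ℝ)).const_mul (‖v‖ ^ 2 / t)).neg.congr_deriv (by simp)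
    have h2 := (analyticAt_cgf (hInt 0)).deriv.differentiableAt.hasDerivAt
    rw [← iteratedDeriv_one, ← iteratedDeriv_succ, iteratedDeriv_one, hdc2] at h2
    refine (h1.add h2).congr_deriv ?_
    ring

lemma integrable_mul_kernel_mul_pow {f : G → ℝ} {M : ℝ} (hf : Measurable f) (h0 : ∀ x, 0 ≤ f x)
    (hM : ∀ x, f x ≤ M) {t : ℝ} (ht : 0 < t) (x : G) :
    Integrable (fun z => f z * Real.exp (-‖z - x‖ ^ 2 / (2 * t)) * ‖z - x‖ ^ 2) := by
  have hInt : Integrable (fun z : G => Real.exp (-‖z‖ ^ 2 / (2 * t)) * ‖z‖ ^ 2) := by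
    refine ((integrable_exp_neg_mul_sq_norm (G := G) (b := 1 / (4 * t)) (by positivity)).const_mul
      (4 * t)).mono' (by fun_prop) (ae_of_all _ fun z => ?_)
    rw [Real.norm_of_nonneg (by positivity)]
    have h1 : ‖z‖ ^ 2 / (4 * t) ≤ Real.exp (‖z‖ ^ 2 / (4 * t)) :=
      (by linarith : ‖z‖ ^ 2 / (4 * t) ≤ ‖z‖ ^ 2 / (4 * t) + 1).trans (Real.add_one_le_exp _)
    have h2 : ‖z‖ ^ 2 ≤ 4 * t * Real.exp (‖z‖ ^ 2 / (4 * t)) := by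
      rw [div_le_iff₀ (by positivity)] at h1
      linarith
    calc _ ≤ Real.exp (-‖z‖ ^ 2 / (2 * t)) * (4 * t * Real.exp (‖z‖ ^ 2 / (4 * t))) := by gcongr
      _ = 4 * t * Real.exp (-(1 / (4 * t)) * ‖z‖ ^ 2) := by
        rw [mul_left_comm, ← Real.exp_add]
        congr 2
        field_simp
        ring
  simpa only [mul_assoc] using integrable_bdd_mul hf h0 hM (hInt.comp_sub_right x)

/-- Along a coisometry `U`, the logarithm of a heat flow satisfies
`2 ∂ₜ log u = Δ (log u) + ‖∇ log u‖²`. Here `p` is the gradient, `D e` the second derivative in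
the direction `e` and `L` the Laplacian. -/
lemma exists_log_heatFlow_derivs {H : Type*} [NormedAddCommGroup H] [InnerProductSpace ℝ H]
    [FiniteDimensional ℝ H] {ι : Type*} [Fintype ι] (b : OrthonormalBasis ι ℝ H)
    (U : H →ₗ[ℝ] G) (hU : U ∘ₗ LinearMap.adjoint U = LinearMap.id)
    {f : G → ℝ} {M : ℝ} (hf : Measurable f) (h0 : ∀ x, 0 ≤ f x)
    (hM : ∀ x, f x ≤ M) (hpos : 0 < volume (Function.support f)) {t : ℝ} (ht : 0 < t) (x : H) :
    ∃ (p : G) (L : ℝ) (D : H → ℝ),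
      HasDerivAt (fun s => Real.log (heatFlow f s (U x))) ((L + ‖p‖ ^ 2) / 2) t ∧
      (∀ e, ∃ φ' : ℝ → ℝ,
        (∀ r, HasDerivAt (fun r : ℝ => Real.log (heatFlow f t (U (x + r • e)))) (φ' r) r) ∧
        φ' 0 = ⟪p, U e⟫ ∧ HasDerivAt φ' (D e) 0) ∧
      ∑ i, D (b i) = L := by
  set y := U x
  set K : G → ℝ := fun z => f z * Real.exp (-‖z - y‖ ^ 2 / (2 * t)) with hK
  have hKm : Measurable K := hf.mul (by fun_prop)
  have hK0 : ∀ z, 0 ≤ K z := fun z => mul_nonneg (h0 z) (Real.exp_pos _).le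
  have hKi : Integrable K := by
    refine integrable_bdd_mul hf h0 hM ?_
    refine (((integrable_exp_neg_mul_sq_norm (G := G) (b := 1 / (2 * t))
      (by positivity)).comp_sub_right y)).congr (ae_of_all _ fun z => ?_)
    simp only
    congr 1
    ring
  have hK2 : Integrable (fun z => K z * ‖z - y‖ ^ 2) :=
    integrable_mul_kernel_mul_pow hf h0 hM ht y
  have hK1 : Integrable (fun z => K z • (z - y)) := by
    refine (hKi.add hK2).mono' (by fun_prop) (ae_of_all _ fun z => ?_)
    rw [norm_smul, Real.norm_of_nonneg (hK0 z), Pi.add_apply]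
    nlinarith [hK0 z, mul_nonneg (hK0 z) (sq_nonneg (‖z - y‖ - 1)),
      mul_nonneg (hK0 z) (sq_nonneg (‖z - y‖))]
  set I := ∫ z, K z
  set p : G := (I⁻¹ * t⁻¹) • ∫ z, K z • (z - y) with hp
  have hpe : ∀ v, (∫ z, K z * ⟪z - y, v⟫) / I / t = ⟪p, v⟫ := fun v => by
    rw [hp, inner_smul_left, real_inner_comm, ← integral_inner hK1]
    simp only [inner_smul_right, real_inner_comm v]
    simp
    ring
  refine ⟨p, (∫ z, K z * ‖z - y‖ ^ 2) / I / t ^ 2 - Module.finrank ℝ G / t - ‖p‖ ^ 2,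
    fun e => (∫ z, K z * ⟪z - y, U e⟫ ^ 2) / I / t ^ 2 - ‖U e‖ ^ 2 / t - ⟪p, U e⟫ ^ 2, ?_, ?_, ?_⟩
  · refine (hasDerivAt_log_heatFlow_time hf h0 hM hpos ht y).congr_deriv ?_
    ring
  · intro e
    obtain ⟨φ', h1, h2, h3⟩ := hasDerivAt_log_heatFlow_space hf h0 hM hpos ht y (U e)
    refine ⟨φ', fun r => ?_, h2.trans (hpe _), ?_⟩
    · simpa using h1 r
    · beta_reduce
      rw [← hpe]
      exact h3
  · rw [Finset.sum_sub_distrib, Finset.sum_sub_distrib, sum_inner_map_sq b U hU,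
      ← Finset.sum_div, ← Finset.sum_div, ← Finset.sum_div, sum_norm_map_sq b U hU,
      ← integral_finsetSum]
    · simp_rw [← Finset.mul_sum, sum_inner_map_sq b U hU]
    · intro i _
      refine (hK2.mul_const (‖U (b i)‖ ^ 2)).mono' (by fun_prop) (ae_of_all _ fun z => ?_)
      rw [Real.norm_of_nonneg (mul_nonneg (hK0 z) (sq_nonneg _)), mul_assoc (K z)]
      refine mul_le_mul_of_nonneg_left ?_ (hK0 z)
      rw [← mul_pow, ← sq_abs]
      gcongr
      exact abs_real_inner_le_norm _ _

end HeatFlow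

lemma IsLocalMax.eq_zero_and_nonpos {φ φ' : ℝ → ℝ} {D : ℝ} (h : ∀ r, HasDerivAt φ (φ' r) r)
    (h' : HasDerivAt φ' D 0) (hmax : IsLocalMax φ 0) : φ' 0 = 0 ∧ D ≤ 0 := by
  have h0 : φ' 0 = 0 := hmax.hasDerivAt_eq_zero (h 0)
  refine ⟨h0, le_of_not_gt fun hD => ?_⟩
  have hd : deriv φ = φ' := funext fun r => (h r).deriv
  have hmin : IsLocalMin φ 0 := isLocalMin_of_deriv_deriv_pos (by rw [hd, h'.deriv]; exact hD)
    (by rw [hd, h0]) (h 0).continuousAt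
  have hev : ∀ᶠ r in 𝓝 (0 : ℝ), φ r = φ 0 := by
    filter_upwards [hmax, hmin] with r h1 h2 using le_antisymm h1 h2
  have hev' : φ' =ᶠ[𝓝 0] fun _ => 0 := by
    filter_upwards [hev.eventually_nhds] with r hr
    exact ((h r).congr_of_eventuallyEq (f₁ := fun _ => φ 0)
      (hr.mono fun _ hs => hs.symm)).unique (hasDerivAt_const r (φ 0))
  have := (h'.congr_of_eventuallyEq hev'.symm).unique (hasDerivAt_const 0 0)
  linarith

lemma HasDerivAt.nonneg_of_le_left {ψ : ℝ → ℝ} {a t : ℝ} (h : HasDerivAt ψ a t)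
    (hle : ∀ᶠ s in 𝓝[<] t, ψ s ≤ ψ t) : 0 ≤ a := by
  have h1 : Tendsto (slope ψ t) (𝓝[<] t) (𝓝 a) :=
    (hasDerivAt_iff_tendsto_slope.1 h).mono_left (nhdsWithin_mono _ fun s hs => ne_of_lt hs)
  refine ge_of_tendsto h1 ?_
  filter_upwards [hle, self_mem_nhdsWithin] with s hs hlt
  rw [slope_def_field]
  exact div_nonneg_of_nonpos (by linarith) (by linarith [Set.mem_Iio.1 hlt])

section MaximumPrinciple

set_option linter.unusedSectionVars false

variable {ι κ : Type*} [Fintype ι] [Fintype κ] {H : Type*} [NormedAddCommGroup H]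
  [InnerProductSpace ℝ H] [FiniteDimensional ℝ H]
  {E : ι → Type*} {F : κ → Type*}
  [∀ i, NormedAddCommGroup (E i)] [∀ i, InnerProductSpace ℝ (E i)]
  [∀ i, FiniteDimensional ℝ (E i)]
  [∀ i, MeasurableSpace (E i)] [∀ i, BorelSpace (E i)]
  [∀ j, NormedAddCommGroup (F j)] [∀ j, InnerProductSpace ℝ (F j)]
  [∀ j, FiniteDimensional ℝ (F j)]
  [∀ j, MeasurableSpace (F j)] [∀ j, BorelSpace (F j)]
  {c : ι → ℝ} {d : κ → ℝ}
  {U : ∀ i, H →ₗ[ℝ] E i} {V : ∀ j, H →ₗ[ℝ] F j}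

/-- If `∑ cᵢ Uᵢ* pᵢ = ∑ dⱼ Vⱼ* qⱼ`, then `∑ cᵢ ‖pᵢ‖² ≤ ∑ dⱼ ‖qⱼ‖²`. -/
lemma sum_norm_sq_le_of_balance (hd : ∀ j, 0 < d j)
    (hsurj : ∀ p : ∀ i, E i, ∃ z, ∀ i, U i z = p i)
    (hfr : ∀ z, ∑ i, c i * ‖U i z‖ ^ 2 = ∑ j, d j * ‖V j z‖ ^ 2)
    (p : ∀ i, E i) (q : ∀ j, F j)
    (hpq : ∀ e, ∑ i, c i * ⟪p i, U i e⟫ = ∑ j, d j * ⟪q j, V j e⟫) :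
    ∑ i, c i * ‖p i‖ ^ 2 ≤ ∑ j, d j * ‖q j‖ ^ 2 := by
  obtain ⟨z, hz⟩ := hsurj p
  have h1 := hpq z
  have h2 := hfr z
  simp only [hz, real_inner_self_eq_norm_sq] at h1 h2
  have h3 : ∑ j, d j * ⟪q j, V j z⟫ ≤ ∑ j, d j * (‖q j‖ ^ 2 / 2 + ‖V j z‖ ^ 2 / 2) := by
    refine Finset.sum_le_sum fun j _ => mul_le_mul_of_nonneg_left ?_ (hd j).le
    have := real_inner_le_norm (q j) (V j z)
    nlinarith [sq_nonneg (‖q j‖ - ‖V j z‖)]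
  have h4 : ∑ j, d j * (‖q j‖ ^ 2 / 2 + ‖V j z‖ ^ 2 / 2) =
      (∑ j, d j * ‖q j‖ ^ 2) / 2 + (∑ j, d j * ‖V j z‖ ^ 2) / 2 := by
    rw [Finset.sum_div, Finset.sum_div, ← Finset.sum_add_distrib]
    exact Finset.sum_congr rfl fun j _ => by ring
  linarith

/-- The logarithm of the ratio of products of heat flows, decreased by `δ t`. -/
def logRatio (c : ι → ℝ) (d : κ → ℝ) (U : ∀ i, H →ₗ[ℝ] E i) (V : ∀ j, H →ₗ[ℝ] F j)
    (f : ∀ i, E i → ℝ) (g : ∀ j, F j → ℝ) (δ t : ℝ) (x : H) : ℝ :=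
  ∑ i, c i * Real.log (heatFlow (f i) t (U i x)) -
    ∑ j, d j * Real.log (heatFlow (g j) t (V j x)) - δ * t

lemma not_isLocalMax_logRatio (hd : ∀ j, 0 < d j)
    (hU : ∀ i, U i ∘ₗ LinearMap.adjoint (U i) = LinearMap.id)
    (hV : ∀ j, V j ∘ₗ LinearMap.adjoint (V j) = LinearMap.id)
    (hsurj : ∀ p : ∀ i, E i, ∃ z, ∀ i, U i z = p i)
    (hfr : ∀ z, ∑ i, c i * ‖U i z‖ ^ 2 = ∑ j, d j * ‖V j z‖ ^ 2)
    {f : ∀ i, E i → ℝ} {g : ∀ j, F j → ℝ} {M : ℝ}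
    (hf : ∀ i, Measurable (f i)) (hg : ∀ j, Measurable (g j))
    (hf0 : ∀ i x, 0 ≤ f i x) (hg0 : ∀ j x, 0 ≤ g j x)
    (hfM : ∀ i x, f i x ≤ M) (hgM : ∀ j x, g j x ≤ M)
    (hfs : ∀ i, 0 < volume (Function.support (f i)))
    (hgs : ∀ j, 0 < volume (Function.support (g j)))
    {δ t : ℝ} (hδ : 0 < δ) (ht : 0 < t) {x : H}
    (htime : ∀ᶠ s in 𝓝[<] t, logRatio c d U V f g δ s x ≤ logRatio c d U V f g δ t x)
    (hspace : IsLocalMax (logRatio c d U V f g δ t) x) : False := by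
  have b := stdOrthonormalBasis ℝ H
  choose p L D hp1 hp2 hp3 using fun i =>
    exists_log_heatFlow_derivs b (U i) (hU i) (hf i) (hf0 i) (hfM i) (hfs i) ht x
  choose q L' D' hq1 hq2 hq3 using fun j =>
    exists_log_heatFlow_derivs b (V j) (hV j) (hg j) (hg0 j) (hgM j) (hgs j) ht x
  have h1 : 0 ≤ ∑ i, c i * ((L i + ‖p i‖ ^ 2) / 2) - ∑ j, d j * ((L' j + ‖q j‖ ^ 2) / 2) - δ := by
    refine HasDerivAt.nonneg_of_le_left (ψ := fun s => logRatio c d U V f g δ s x) ?_ htime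
    refine ((HasDerivAt.fun_sum fun i _ => (hp1 i).const_mul (c i)).sub
      (HasDerivAt.fun_sum fun j _ => (hq1 j).const_mul (d j))).sub ?_
    simpa using (hasDerivAt_id t).const_mul δ
  have h2 : ∀ e, ∑ i, c i * ⟪p i, U i e⟫ - ∑ j, d j * ⟪q j, V j e⟫ = 0 ∧
      ∑ i, c i * D i e - ∑ j, d j * D' j e ≤ 0 := fun e => by
    choose φ hφ1 hφ2 hφ3 using fun i => hp2 i e
    choose χ hχ1 hχ2 hχ3 using fun j => hq2 j e
    have key := IsLocalMax.eq_zero_and_nonpos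
      (φ := fun r : ℝ => logRatio c d U V f g δ t (x + r • e))
      (φ' := fun r => ∑ i, c i * φ i r - ∑ j, d j * χ j r)
      (D := ∑ i, c i * D i e - ∑ j, d j * D' j e) (fun r => ?_) ?_ ?_
    · simpa only [hφ2, hχ2] using key
    · exact ((HasDerivAt.fun_sum fun i _ => (hφ1 i r).const_mul (c i)).sub
        (HasDerivAt.fun_sum fun j _ => (hχ1 j r).const_mul (d j))).sub_const _
    · exact (HasDerivAt.fun_sum fun i _ => (hφ3 i).const_mul (c i)).sub
        (HasDerivAt.fun_sum fun j _ => (hχ3 j).const_mul (d j))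
    · have hc : Tendsto (fun r : ℝ => x + r • e) (𝓝 0) (𝓝 x) := by
        have : Continuous fun r : ℝ => x + r • e := by fun_prop
        simpa using this.tendsto 0
      have := hc.eventually hspace
      simpa [IsLocalMax, IsMaxFilter] using this
  have h3 := sum_norm_sq_le_of_balance hd hsurj hfr p q fun e => sub_eq_zero.1 (h2 e).1
  have h4 : ∑ i, c i * L i - ∑ j, d j * L' j ≤ 0 := by
    have : ∑ a, (∑ i, c i * D i (b a) - ∑ j, d j * D' j (b a)) ≤ 0 :=
      Finset.sum_nonpos fun a _ => (h2 (b a)).2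
    have e1 : ∑ a, ∑ i, c i * D i (b a) = ∑ i, c i * L i := by
      rw [Finset.sum_comm]
      simp only [← Finset.mul_sum, hp3]
    have e2 : ∑ a, ∑ j, d j * D' j (b a) = ∑ j, d j * L' j := by
      rw [Finset.sum_comm]
      simp only [← Finset.mul_sum, hq3]
    rwa [Finset.sum_sub_distrib, e1, e2] at this
  have h5 : ∑ i, c i * ((L i + ‖p i‖ ^ 2) / 2) =
      (∑ i, c i * L i) / 2 + (∑ i, c i * ‖p i‖ ^ 2) / 2 := by
    rw [Finset.sum_div, Finset.sum_div, ← Finset.sum_add_distrib]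
    exact Finset.sum_congr rfl fun j _ => by ring
  have h6 : ∑ j, d j * ((L' j + ‖q j‖ ^ 2) / 2) =
      (∑ j, d j * L' j) / 2 + (∑ j, d j * ‖q j‖ ^ 2) / 2 := by
    rw [Finset.sum_div, Finset.sum_div, ← Finset.sum_add_distrib]
    exact Finset.sum_congr rfl fun j _ => by ring
  linarith

end MaximumPrinciple

section Semicontinuity

lemma UpperSemicontinuous.mul_of_nonneg {X : Type*} [TopologicalSpace X] {u v : X → ℝ}
    (hu : UpperSemicontinuous u) (hv : UpperSemicontinuous v) (hu0 : ∀ x, 0 ≤ u x)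
    (hv0 : ∀ x, 0 ≤ v x) : UpperSemicontinuous fun x => u x * v x := by
  intro x y hy
  have hc : Tendsto (fun η : ℝ => (u x + η) * (v x + η)) (𝓝[>] 0) (𝓝 (u x * v x)) := by
    have : Continuous fun η : ℝ => (u x + η) * (v x + η) := by fun_prop
    simpa using (this.tendsto 0).mono_left nhdsWithin_le_nhds
  obtain ⟨η, hη, hη0⟩ := ((hc.eventually (gt_mem_nhds hy)).and self_mem_nhdsWithin).exists
  have hη0 : 0 < η := hη0
  filter_upwards [hu x (u x + η) (by linarith), hv x (v x + η) (by linarith)] with z h1 h2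
  exact (mul_le_mul h1.le h2.le (hv0 z) (by linarith [hu0 x])).trans_lt hη

lemma UpperSemicontinuous.prod_of_nonneg {X ι : Type*} [TopologicalSpace X] {u : ι → X → ℝ}
    (s : Finset ι) (hu : ∀ i, UpperSemicontinuous (u i)) (hu0 : ∀ i x, 0 ≤ u i x) :
    UpperSemicontinuous fun x => ∏ i ∈ s, u i x := by
  classical
  induction s using Finset.induction_on with
  | empty => simpa using upperSemicontinuous_const
  | insert a s ha ih =>
    simp only [Finset.prod_insert ha]
    exact UpperSemicontinuous.mul_of_nonneg (hu a) ih (hu0 a) fun x => Finset.prod_nonneg fun i _ => hu0 i x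

variable {G : Type*} [NormedAddCommGroup G] [InnerProductSpace ℝ G] [FiniteDimensional ℝ G]
  [MeasurableSpace G] [BorelSpace G]

lemma integrable_exp_neg_sq_norm_half :
    Integrable (fun y : G => Real.exp (-‖y‖ ^ 2 / 2)) := by
  refine (integrable_exp_neg_mul_sq_norm (G := G) (b := 1 / 2) (by norm_num)).congr
    (ae_of_all _ fun y => ?_)
  simp only
  congr 1
  ring

lemma integral_exp_neg_sq_norm_half :
    ∫ y : G, Real.exp (-‖y‖ ^ 2 / 2) = (2 * Real.pi) ^ ((Module.finrank ℝ G : ℝ) / 2) := by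
  have := GaussianFourier.integral_rexp_neg_mul_sq_norm (V := G) (b := 1 / 2) (by norm_num)
  rw [show Real.pi / (1 / 2) = 2 * Real.pi by ring] at this
  rw [← this]
  refine integral_congr_ae (ae_of_all _ fun y => ?_)
  simp only
  congr 1
  ring

lemma heatFlow_zero (f : G → ℝ) (x : G) :
    heatFlow f 0 x = f x * (2 * Real.pi) ^ ((Module.finrank ℝ G : ℝ) / 2) := by
  simp only [heatFlow, Real.sqrt_zero, zero_smul, add_zero]
  rw [integral_const_mul, integral_exp_neg_sq_norm_half]

lemma integrable_heatFlow {f : G → ℝ} {M : ℝ} (hf : Measurable f) (h0 : ∀ x, 0 ≤ f x)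
    (hM : ∀ x, f x ≤ M) (t : ℝ) (x : G) :
    Integrable fun y => f (x + √t • y) * Real.exp (-‖y‖ ^ 2 / 2) :=
  integrable_bdd_mul (f := fun y => f (x + √t • y)) (hf.comp (by fun_prop)) (fun _ => h0 _)
    (fun _ => hM _) integrable_exp_neg_sq_norm_half

lemma heatFlow_nonneg {f : G → ℝ} (h0 : ∀ x, 0 ≤ f x) (t : ℝ) (x : G) : 0 ≤ heatFlow f t x :=
  integral_nonneg fun _ => mul_nonneg (h0 _) (Real.exp_pos _).le

lemma lowerSemicontinuous_heatFlow {f : G → ℝ} {M : ℝ} (hf : LowerSemicontinuous f)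
    (h0 : ∀ x, 0 ≤ f x) (hM : ∀ x, f x ≤ M) :
    LowerSemicontinuous fun q : ℝ × G => heatFlow f q.1 q.2 := by
  set φ : ℝ × G → G → ℝ := fun q y => f (q.2 + √q.1 • y) * Real.exp (-‖y‖ ^ 2 / 2)
  have hφ0 : ∀ q y, 0 ≤ φ q y := fun q y => mul_nonneg (h0 _) (Real.exp_pos _).le
  have hφm : ∀ q, Measurable (φ q) := fun q =>
    (hf.measurable.comp (by fun_prop)).mul (by fun_prop)
  have hlsc : ∀ y, LowerSemicontinuous fun q => ENNReal.ofReal (φ q y) := fun y => by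
    have h1 : LowerSemicontinuous fun q : ℝ × G => f (q.2 + √q.1 • y) :=
      LowerSemicontinuous.comp hf (g := fun q : ℝ × G => q.2 + √q.1 • y) (by fun_prop)
    refine Continuous.comp_lowerSemicontinuous
      (g := fun r => ENNReal.ofReal (r * Real.exp (-‖y‖ ^ 2 / 2))) 
      (ENNReal.continuous_ofReal.comp (by fun_prop)) h1 ?_
    intro r s hrs
    exact ENNReal.ofReal_le_ofReal (mul_le_mul_of_nonneg_right hrs (Real.exp_pos _).le)
  have heq : ∀ q : ℝ × G, ENNReal.ofReal (heatFlow f q.1 q.2) = ∫⁻ y, ENNReal.ofReal (φ q y) :=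
    fun q => ofReal_integral_eq_lintegral_ofReal
      (integrable_heatFlow hf.measurable h0 hM q.1 q.2) (ae_of_all _ (hφ0 q))
  have hL : LowerSemicontinuous fun q : ℝ × G => ENNReal.ofReal (heatFlow f q.1 q.2) := by
    simp only [heq]
    refine lowerSemicontinuous_iff_le_liminf.2 fun q => ?_
    refine le_trans (lintegral_mono fun y => ?_)
      (lintegral_liminf_le fun q => (hφm q).ennreal_ofReal)
    exact (hlsc y).le_liminf q
  intro q r hr
  rcases lt_or_ge r 0 with h | h
  · exact Eventually.of_forall fun q' => h.trans_le (heatFlow_nonneg h0 _ _)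
  · filter_upwards [hL q (ENNReal.ofReal r) ((ENNReal.ofReal_lt_ofReal_iff_of_nonneg h).2 hr)]
      with q' hq'
    exact (ENNReal.ofReal_lt_ofReal_iff_of_nonneg h).1 hq'

lemma upperSemicontinuous_heatFlow {f : G → ℝ} {M : ℝ} (hf : UpperSemicontinuous f)
    (h0 : ∀ x, 0 ≤ f x) (hM : ∀ x, f x ≤ M) :
    UpperSemicontinuous fun q : ℝ × G => heatFlow f q.1 q.2 := by
  have hanti : Antitone fun r : ℝ => M - r := fun r s h => sub_le_sub_left h _
  have h1 : LowerSemicontinuous fun x => M - f x :=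
    Continuous.comp_upperSemicontinuous_antitone (g := fun r => M - r) (by fun_prop) hf hanti
  have h2 := lowerSemicontinuous_heatFlow (M := M) h1 (fun x => by linarith [hM x])
    fun x => by linarith [h0 x]
  have h3 : ∀ q : ℝ × G, heatFlow f q.1 q.2 =
      M * (∫ y : G, Real.exp (-‖y‖ ^ 2 / 2)) - heatFlow (fun x => M - f x) q.1 q.2 := fun q => by
    rw [heatFlow, heatFlow, ← integral_const_mul, ← integral_sub
      (integrable_exp_neg_sq_norm_half.const_mul M)
      (integrable_heatFlow (M := M) h1.measurable (fun x => by linarith [hM x])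
        (fun x => by linarith [h0 x]) _ _)]
    refine integral_congr_ae (ae_of_all _ fun y => ?_)
    ring
  simp only [h3]
  exact Continuous.comp_lowerSemicontinuous_antitone
    (g := fun r => M * (∫ y : G, Real.exp (-‖y‖ ^ 2 / 2)) - r) (by fun_prop) h2
    fun r s h => sub_le_sub_left h _

lemma heatFlow_ge {f : G → ℝ} {ε M : ℝ} (hf : Measurable f) (h0 : ∀ x, 0 ≤ f x)
    (hε : ∀ x, ε ≤ f x) (hM : ∀ x, f x ≤ M) (t : ℝ) (x : G) :
    ε * (2 * Real.pi) ^ ((Module.finrank ℝ G : ℝ) / 2) ≤ heatFlow f t x := by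
  rw [← integral_exp_neg_sq_norm_half, ← integral_const_mul]
  refine integral_mono (integrable_exp_neg_sq_norm_half.const_mul ε)
    (integrable_heatFlow hf h0 hM t x) fun y => ?_
  exact mul_le_mul_of_nonneg_right (hε _) (Real.exp_pos _).le

/-- Gaussian decay of the heat flow of a bounded function supported in a ball. -/
lemma heatFlow_le_of_support {f : G → ℝ} {R M : ℝ} (hf : Measurable f) (h0 : ∀ x, 0 ≤ f x)
    (hM : ∀ x, f x ≤ M) (hR : ∀ x, f x ≠ 0 → ‖x‖ ≤ R) {t : ℝ} (ht1 : t ≤ 1)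
    (x : G) : heatFlow f t x ≤ M * Real.exp (R ^ 2 / 4) *
      (∫ y : G, Real.exp (-(1 / 4) * ‖y‖ ^ 2)) * Real.exp (-(1 / 8) * ‖x‖ ^ 2) := by
  rw [← integral_const_mul, ← integral_mul_const]
  refine integral_mono (integrable_heatFlow hf h0 hM t x)
    (((integrable_exp_neg_mul_sq_norm (by norm_num)).const_mul _).mul_const _) fun y => ?_
  have hM0 : 0 ≤ M := (h0 0).trans (hM 0)
  beta_reduce
  by_cases h : f (x + √t • y) = 0
  · rw [h, zero_mul]
    positivity
  · have h1 : ‖x + √t • y‖ ≤ R := hR _ h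
    have h2 : ‖x‖ ≤ R + ‖y‖ := by
      have e1 : ‖x‖ ≤ ‖x + √t • y‖ + ‖√t • y‖ := by
        simpa using norm_sub_le (x + √t • y) (√t • y)
      have e2 : ‖√t • y‖ ≤ ‖y‖ := by
        rw [norm_smul, Real.norm_of_nonneg (Real.sqrt_nonneg t)]
        exact mul_le_of_le_one_left (norm_nonneg _) (Real.sqrt_le_one.2 ht1)
      linarith
    have h3 : ‖x‖ ^ 2 ≤ 2 * R ^ 2 + 2 * ‖y‖ ^ 2 := by
      nlinarith [norm_nonneg x, norm_nonneg y, sq_nonneg (R - ‖y‖), (norm_nonneg _).trans h1]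
    calc f (x + √t • y) * Real.exp (-‖y‖ ^ 2 / 2)
        ≤ M * Real.exp (R ^ 2 / 4 + -(1 / 4) * ‖y‖ ^ 2 + -(1 / 8) * ‖x‖ ^ 2) := by
          gcongr
          · exact hM _
          · linarith
      _ = _ := by rw [Real.exp_add, Real.exp_add]; ring

end Semicontinuity

section Comparison

set_option linter.unusedSectionVars false

variable {ι κ : Type*} [Fintype ι] [Fintype κ] {H : Type*} [NormedAddCommGroup H]
  [InnerProductSpace ℝ H] [FiniteDimensional ℝ H]
  {E : ι → Type*} {F : κ → Type*}
  [∀ i, NormedAddCommGroup (E i)] [∀ i, InnerProductSpace ℝ (E i)]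
  [∀ i, FiniteDimensional ℝ (E i)]
  [∀ i, MeasurableSpace (E i)] [∀ i, BorelSpace (E i)]
  [∀ j, NormedAddCommGroup (F j)] [∀ j, InnerProductSpace ℝ (F j)]
  [∀ j, FiniteDimensional ℝ (F j)]
  [∀ j, MeasurableSpace (F j)] [∀ j, BorelSpace (F j)]
  {c : ι → ℝ} {d : κ → ℝ}
  {U : ∀ i, H →ₗ[ℝ] E i} {V : ∀ j, H →ₗ[ℝ] F j}

lemma exists_mul_sq_norm_le (hc : ∀ i, 0 < c i) (hinj : ∀ x, (∀ i, U i x = 0) → x = 0) :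
    ∃ a > 0, ∀ x, a * ‖x‖ ^ 2 ≤ ∑ i, c i * ‖U i x‖ ^ 2 := by
  set T : H →ₗ[ℝ] ∀ i, E i := LinearMap.pi fun i => √(c i) • U i
  have hker : LinearMap.ker T = ⊥ := by
    refine LinearMap.ker_eq_bot'.2 fun x hx => hinj x fun i => ?_
    have := congrFun hx i
    simpa [T, (Real.sqrt_pos.2 (hc i)).ne'] using this
  obtain ⟨K, hK, hT⟩ := T.exists_antilipschitzWith hker
  have hK : (0 : ℝ) < K := hK
  refine ⟨((K : ℝ) ^ 2)⁻¹, by positivity, fun x => ?_⟩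
  have h1 : ‖x‖ ≤ K * ‖T x‖ := by simpa using hT.le_mul_dist x 0
  have hA : 0 ≤ ∑ i, c i * ‖U i x‖ ^ 2 :=
    Finset.sum_nonneg fun i _ => mul_nonneg (hc i).le (sq_nonneg _)
  have h2 : ‖T x‖ ≤ √(∑ i, c i * ‖U i x‖ ^ 2) := by
    refine (pi_norm_le_iff_of_nonneg (Real.sqrt_nonneg _)).2 fun i => ?_
    refine Real.le_sqrt_of_sq_le ?_
    have : ‖T x i‖ ^ 2 = c i * ‖U i x‖ ^ 2 := by
      simp only [T, LinearMap.pi_apply, LinearMap.smul_apply, norm_smul, mul_pow,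
        Real.norm_of_nonneg (Real.sqrt_nonneg _), Real.sq_sqrt (hc i).le]
    rw [this]
    exact Finset.single_le_sum (f := fun i => c i * ‖U i x‖ ^ 2)
      (fun i _ => mul_nonneg (hc i).le (sq_nonneg _)) (Finset.mem_univ i)
  have h3 : ‖x‖ ^ 2 ≤ K ^ 2 * ∑ i, c i * ‖U i x‖ ^ 2 := by
    rw [← Real.sq_sqrt hA, ← mul_pow]
    exact pow_le_pow_left₀ (norm_nonneg _) (h1.trans (by gcongr)) 2
  rw [inv_mul_le_iff₀ (by positivity)]
  exact h3

lemma sum_mul_finrank_eq (hU : ∀ i, U i ∘ₗ LinearMap.adjoint (U i) = LinearMap.id)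
    (hV : ∀ j, V j ∘ₗ LinearMap.adjoint (V j) = LinearMap.id)
    (hfr : ∀ z, ∑ i, c i * ‖U i z‖ ^ 2 = ∑ j, d j * ‖V j z‖ ^ 2) :
    ∑ i, c i * (Module.finrank ℝ (E i) : ℝ) = ∑ j, d j * (Module.finrank ℝ (F j) : ℝ) := by
  have b := stdOrthonormalBasis ℝ H
  simp_rw [← fun i => sum_norm_map_sq b (U i) (hU i), ← fun j => sum_norm_map_sq b (V j) (hV j),
    Finset.mul_sum]
  rw [Finset.sum_comm, Finset.sum_congr rfl fun a _ => hfr (b a), Finset.sum_comm]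

/-- The ratio of products of heat flows, damped by `exp (-δ t)`. -/
def heatRatio (c : ι → ℝ) (d : κ → ℝ) (U : ∀ i, H →ₗ[ℝ] E i) (V : ∀ j, H →ₗ[ℝ] F j)
    (f : ∀ i, E i → ℝ) (g : ∀ j, F j → ℝ) (δ : ℝ) (q : ℝ × H) : ℝ :=
  Real.exp (-(δ * q.1)) * ((∏ i, heatFlow (f i) q.1 (U i q.2) ^ c i) *
    ∏ j, heatFlow (g j) q.1 (V j q.2) ^ (-d j))

lemma upperSemicontinuous_heatRatio (hc : ∀ i, 0 < c i) (hd : ∀ j, 0 < d j)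
    {f : ∀ i, E i → ℝ} {g : ∀ j, F j → ℝ} {ε M : ℝ} (hε : 0 < ε)
    (hf : ∀ i, UpperSemicontinuous (f i)) (hg : ∀ j, LowerSemicontinuous (g j))
    (hf0 : ∀ i x, 0 ≤ f i x) (hgε : ∀ j x, ε ≤ g j x)
    (hfM : ∀ i x, f i x ≤ M) (hgM : ∀ j x, g j x ≤ M) (δ : ℝ) :
    UpperSemicontinuous (heatRatio c d U V f g δ) := by
  have hg0 : ∀ j x, 0 ≤ g j x := fun j x => hε.le.trans (hgε j x)
  refine UpperSemicontinuous.mul_of_nonneg (Continuous.upperSemicontinuous (by fun_prop))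
    (UpperSemicontinuous.mul_of_nonneg
      (UpperSemicontinuous.prod_of_nonneg _ (fun i => ?_) ?_)
      (UpperSemicontinuous.prod_of_nonneg _ (fun j => ?_) ?_) ?_ ?_) ?_ ?_
  · have hcont : Continuous fun q : ℝ × H => (q.1, U i q.2) :=
      continuous_fst.prodMk ((U i).continuous_of_finiteDimensional.comp continuous_snd)
    have h1 : UpperSemicontinuous fun q : ℝ × H => heatFlow (f i) q.1 (U i q.2) :=
      UpperSemicontinuous.comp (f := fun q : ℝ × E i => heatFlow (f i) q.1 q.2)
        (upperSemicontinuous_heatFlow (hf i) (hf0 i) (hfM i)) hcont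
    have h2 := Continuous.comp_upperSemicontinuous (g := fun r : ℝ => max r 0 ^ c i)
      ((continuous_id.max continuous_const).rpow_const fun _ => Or.inr (hc i).le) h1
      fun r s h => Real.rpow_le_rpow (le_max_right _ _) (max_le_max_right _ h) (hc i).le
    simpa only [Function.comp_def, max_eq_left (heatFlow_nonneg (hf0 i) _ _)] using h2
  · exact fun i q => Real.rpow_nonneg (heatFlow_nonneg (hf0 i) _ _) _
  · have hcont : Continuous fun q : ℝ × H => (q.1, V j q.2) :=
      continuous_fst.prodMk ((V j).continuous_of_finiteDimensional.comp continuous_snd)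
    have h1 : LowerSemicontinuous fun q : ℝ × H => heatFlow (g j) q.1 (V j q.2) :=
      LowerSemicontinuous.comp (f := fun q : ℝ × F j => heatFlow (g j) q.1 q.2)
        (lowerSemicontinuous_heatFlow (hg j) (hg0 j) (hgM j)) hcont
    set e := ε * (2 * Real.pi) ^ ((Module.finrank ℝ (F j) : ℝ) / 2)
    have he : 0 < e := by positivity
    have h2 := Continuous.comp_lowerSemicontinuous_antitone (g := fun r : ℝ => max r e ^ (-d j))
      ((continuous_id.max continuous_const).rpow_const fun _ =>
        Or.inl (he.trans_le (le_max_right _ _)).ne') h1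
      fun r s h => Real.rpow_le_rpow_of_nonpos (he.trans_le (le_max_right _ _))
        (max_le_max_right _ h) (neg_nonpos.2 (hd j).le)
    simpa only [Function.comp_def, max_eq_left (heatFlow_ge (hg j).measurable (hg0 j) (hgε j) (hgM j) _ _),
      e] using h2
  · exact fun j q => Real.rpow_nonneg (heatFlow_nonneg (hg0 j) _ _) _
  · exact fun q => Finset.prod_nonneg fun i _ => Real.rpow_nonneg (heatFlow_nonneg (hf0 i) _ _) _
  · exact fun q => Finset.prod_nonneg fun i _ => Real.rpow_nonneg (heatFlow_nonneg (hg0 i) _ _) _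
  · exact fun q => (Real.exp_pos _).le
  · exact fun q => mul_nonneg
      (Finset.prod_nonneg fun i _ => Real.rpow_nonneg (heatFlow_nonneg (hf0 i) _ _) _)
      (Finset.prod_nonneg fun i _ => Real.rpow_nonneg (heatFlow_nonneg (hg0 i) _ _) _)

lemma prod_gaussian_rpow (s : ι → ℝ) :
    ∏ i, ((2 * Real.pi) ^ (s i / 2)) ^ c i = (2 * Real.pi) ^ ((∑ i, c i * s i) / 2) := by
  rw [Finset.sum_div, Real.rpow_sum_of_pos (by positivity)]
  refine Finset.prod_congr rfl fun i _ => ?_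
  rw [← Real.rpow_mul (by positivity)]
  congr 1
  ring

lemma prod_rpow_neg {r : κ → ℝ} (hr : ∀ j, 0 ≤ r j) :
    ∏ j, r j ^ (-d j) = (∏ j, r j ^ d j)⁻¹ := by
  rw [← Finset.prod_inv_distrib]
  exact Finset.prod_congr rfl fun j _ => Real.rpow_neg (hr j) _

lemma heatRatio_zero_le_one
    (hU : ∀ i, U i ∘ₗ LinearMap.adjoint (U i) = LinearMap.id)
    (hV : ∀ j, V j ∘ₗ LinearMap.adjoint (V j) = LinearMap.id)
    (hfr : ∀ z, ∑ i, c i * ‖U i z‖ ^ 2 = ∑ j, d j * ‖V j z‖ ^ 2)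
    {f : ∀ i, E i → ℝ} {g : ∀ j, F j → ℝ}
    (hf0 : ∀ i x, 0 ≤ f i x) (hg0 : ∀ j x, 0 < g j x)
    (hyp : ∀ x, ∏ i, f i (U i x) ^ c i ≤ ∏ j, g j (V j x) ^ d j) (δ : ℝ) (x : H) :
    heatRatio c d U V f g δ (0, x) ≤ 1 := by
  have h1 : ∏ i, heatFlow (f i) 0 (U i x) ^ c i = (∏ i, f i (U i x) ^ c i) *
      (2 * Real.pi) ^ ((∑ i, c i * (Module.finrank ℝ (E i) : ℝ)) / 2) := by
    rw [← prod_gaussian_rpow, ← Finset.prod_mul_distrib]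
    refine Finset.prod_congr rfl fun i _ => ?_
    rw [heatFlow_zero, Real.mul_rpow (hf0 i _) (by positivity)]
  have h2 : ∏ j, heatFlow (g j) 0 (V j x) ^ d j = (∏ j, g j (V j x) ^ d j) *
      (2 * Real.pi) ^ ((∑ j, d j * (Module.finrank ℝ (F j) : ℝ)) / 2) := by
    rw [← prod_gaussian_rpow, ← Finset.prod_mul_distrib]
    refine Finset.prod_congr rfl fun j _ => ?_
    rw [heatFlow_zero, Real.mul_rpow (hg0 j _).le (by positivity)]
  have h3 : 0 < ∏ j, g j (V j x) ^ d j := Finset.prod_pos fun j _ => Real.rpow_pos_of_pos (hg0 j _) _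
  simp only [heatRatio, mul_zero, neg_zero, Real.exp_zero, one_mul]
  rw [prod_rpow_neg fun j => heatFlow_nonneg (fun y => (hg0 j y).le) _ _, h1, h2,
    sum_mul_finrank_eq hU hV hfr, ← div_eq_mul_inv]
  refine div_le_one_of_le₀ ?_ (by positivity)
  gcongr
  exact hyp x

lemma exists_heatRatio_le_one_of_le_norm (hc : ∀ i, 0 < c i) (hd : ∀ j, 0 < d j)
    (hinj : ∀ x, (∀ i, U i x = 0) → x = 0)
    {f : ∀ i, E i → ℝ} {g : ∀ j, F j → ℝ} {ε M R : ℝ} (hε : 0 < ε)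
    (hf : ∀ i, Measurable (f i)) (hg : ∀ j, Measurable (g j))
    (hf0 : ∀ i x, 0 ≤ f i x) (hgε : ∀ j x, ε ≤ g j x)
    (hfM : ∀ i x, f i x ≤ M) (hgM : ∀ j x, g j x ≤ M) (hR : ∀ i x, f i x ≠ 0 → ‖x‖ ≤ R)
    {δ : ℝ} (hδ : 0 ≤ δ) :
    ∃ ρ : ℝ, ∀ t x, 0 ≤ t → t ≤ 1 → ρ ≤ ‖x‖ → heatRatio c d U V f g δ (t, x) ≤ 1 := by
  have hg0 : ∀ j x, 0 ≤ g j x := fun j x => hε.le.trans (hgε j x)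
  obtain ⟨a, ha, hax⟩ := exists_mul_sq_norm_le hc hinj
  have hM0 : ∀ i : ι, 0 ≤ M := fun i => (hf0 i 0).trans (hfM i 0)
  set C : ι → ℝ := fun i => M * Real.exp (R ^ 2 / 4) *
    ∫ y : E i, Real.exp (-(1 / 4) * ‖y‖ ^ 2)
  have hC : ∀ i, 0 ≤ C i := fun i => mul_nonneg (mul_nonneg (hM0 i) (Real.exp_pos _).le)
    (integral_nonneg fun _ => (Real.exp_pos _).le)
  set A := ∏ i, C i ^ c i
  have hA : 0 ≤ A := Finset.prod_nonneg fun i _ => Real.rpow_nonneg (hC i) _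
  set P := ∏ j, (ε * (2 * Real.pi) ^ ((Module.finrank ℝ (F j) : ℝ) / 2)) ^ d j
  have hP : 0 < P := Finset.prod_pos fun j _ => by positivity
  refine ⟨max 1 (8 * A / (a * P)), fun t x ht0 ht1 hx => ?_⟩
  have hN : ∏ i, heatFlow (f i) t (U i x) ^ c i ≤ A * Real.exp (-(a * ‖x‖ ^ 2 / 8)) := by
    calc ∏ i, heatFlow (f i) t (U i x) ^ c i
        ≤ ∏ i, (C i * Real.exp (-(1 / 8) * ‖U i x‖ ^ 2)) ^ c i := by
          refine Finset.prod_le_prod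
            (fun i _ => Real.rpow_nonneg (heatFlow_nonneg (hf0 i) _ _) _) fun i _ =>
            Real.rpow_le_rpow (heatFlow_nonneg (hf0 i) _ _) ?_ (hc i).le
          exact heatFlow_le_of_support (hf i) (hf0 i) (hfM i) (hR i) ht1 _
      _ = A * Real.exp (-((∑ i, c i * ‖U i x‖ ^ 2) / 8)) := by
          rw [Finset.sum_div, ← Finset.sum_neg_distrib, Real.exp_sum, ← Finset.prod_mul_distrib]
          refine Finset.prod_congr rfl fun i _ => ?_
          rw [Real.mul_rpow (hC i) (Real.exp_pos _).le, ← Real.exp_mul]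
          congr 2
          ring
      _ ≤ _ := by
          gcongr
          exact hax x
  have hle : A * Real.exp (-(a * ‖x‖ ^ 2 / 8)) ≤ P := by
    have h1 : 1 ≤ ‖x‖ := (le_max_left _ _).trans hx
    have h2 : 8 * A / (a * P) ≤ ‖x‖ := (le_max_right _ _).trans hx
    rw [div_le_iff₀ (by positivity)] at h2
    have h3 : a * ‖x‖ ^ 2 / 8 ≤ Real.exp (a * ‖x‖ ^ 2 / 8) := by
      linarith [Real.add_one_le_exp (a * ‖x‖ ^ 2 / 8)]
    rw [Real.exp_neg, ← div_eq_mul_inv, div_le_iff₀ (Real.exp_pos _)]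
    have h4 : ‖x‖ ≤ ‖x‖ ^ 2 := by nlinarith
    have h5 : ‖x‖ * (a * P) ≤ ‖x‖ ^ 2 * (a * P) := by gcongr
    calc A ≤ P * (a * ‖x‖ ^ 2 / 8) := by linarith
      _ ≤ _ := by gcongr
  have hPle : P ≤ ∏ j, heatFlow (g j) t (V j x) ^ d j :=
    Finset.prod_le_prod (fun j _ => by positivity) fun j _ => Real.rpow_le_rpow (by positivity)
      (heatFlow_ge (hg j) (hg0 j) (hgε j) (hgM j) _ _) (hd j).le
  simp only [heatRatio]
  rw [prod_rpow_neg fun j => heatFlow_nonneg (hg0 j) _ _, ← div_eq_mul_inv]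
  have h6 : Real.exp (-(δ * t)) ≤ 1 := Real.exp_le_one_iff.2 (by nlinarith [mul_nonneg hδ ht0])
  refine mul_le_one₀ h6 (div_nonneg (Finset.prod_nonneg fun i _ =>
    Real.rpow_nonneg (heatFlow_nonneg (hf0 i) _ _) _) (hP.le.trans hPle)) ?_
  exact div_le_one_of_le₀ (hN.trans (hle.trans hPle)) (hP.le.trans hPle)

lemma log_heatRatio {f : ∀ i, E i → ℝ} {g : ∀ j, F j → ℝ} {δ t : ℝ} {x : H}
    (hf : ∀ i, 0 < heatFlow (f i) t (U i x)) (hg : ∀ j, 0 < heatFlow (g j) t (V j x)) :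
    Real.log (heatRatio c d U V f g δ (t, x)) = logRatio c d U V f g δ t x := by
  have h1 : ∀ i, 0 < heatFlow (f i) t (U i x) ^ c i := fun i => Real.rpow_pos_of_pos (hf i) _
  have h2 : ∀ j, 0 < heatFlow (g j) t (V j x) ^ (-d j) := fun j => Real.rpow_pos_of_pos (hg j) _
  have h3 := Finset.prod_pos fun i (_ : i ∈ Finset.univ) => h1 i
  have h4 := Finset.prod_pos fun j (_ : j ∈ Finset.univ) => h2 j
  rw [heatRatio, Real.log_mul (Real.exp_pos _).ne' (mul_pos h3 h4).ne',
    Real.log_mul h3.ne' h4.ne', Real.log_exp, Real.log_prod fun i _ => (h1 i).ne',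
    Real.log_prod fun j _ => (h2 j).ne', logRatio]
  simp only [Real.log_rpow (hf _), Real.log_rpow (hg _), neg_mul, Finset.sum_neg_distrib]
  ring

lemma heatRatio_pos {f : ∀ i, E i → ℝ} {g : ∀ j, F j → ℝ} {δ t : ℝ} {x : H}
    (hf : ∀ i, 0 < heatFlow (f i) t (U i x)) (hg : ∀ j, 0 < heatFlow (g j) t (V j x)) :
    0 < heatRatio c d U V f g δ (t, x) :=
  mul_pos (Real.exp_pos _) (mul_pos (Finset.prod_pos fun i _ => Real.rpow_pos_of_pos (hf i) _)
    (Finset.prod_pos fun j _ => Real.rpow_pos_of_pos (hg j) _))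

end Comparison

section Comparison

variable {ι κ : Type*} [Fintype ι] [Fintype κ] {H : Type*} [NormedAddCommGroup H]
  [InnerProductSpace ℝ H] [FiniteDimensional ℝ H]
  {E : ι → Type*} {F : κ → Type*}
  [∀ i, NormedAddCommGroup (E i)] [∀ i, InnerProductSpace ℝ (E i)]
  [∀ i, FiniteDimensional ℝ (E i)]
  [∀ i, MeasurableSpace (E i)] [∀ i, BorelSpace (E i)]
  [∀ j, NormedAddCommGroup (F j)] [∀ j, InnerProductSpace ℝ (F j)]
  [∀ j, FiniteDimensional ℝ (F j)]
  [∀ j, MeasurableSpace (F j)] [∀ j, BorelSpace (F j)]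
  {c : ι → ℝ} {d : κ → ℝ}
  {U : ∀ i, H →ₗ[ℝ] E i} {V : ∀ j, H →ₗ[ℝ] F j}

/-- The gaussian form of the inequality for semicontinuous functions, proved by applying the
maximum principle to the ratio of the heat flows. -/
theorem prod_heatFlow_le_of_semicontinuous (hc : ∀ i, 0 < c i) (hd : ∀ j, 0 < d j)
    (hU : ∀ i, U i ∘ₗ LinearMap.adjoint (U i) = LinearMap.id)
    (hV : ∀ j, V j ∘ₗ LinearMap.adjoint (V j) = LinearMap.id)
    (hinj : ∀ x, (∀ i, U i x = 0) → x = 0)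
    (hsurj : ∀ p : ∀ i, E i, ∃ z, ∀ i, U i z = p i)
    (hfr : ∀ z, ∑ i, c i * ‖U i z‖ ^ 2 = ∑ j, d j * ‖V j z‖ ^ 2)
    {f : ∀ i, E i → ℝ} {g : ∀ j, F j → ℝ} {ε M R : ℝ} (hε : 0 < ε)
    (hf : ∀ i, UpperSemicontinuous (f i)) (hg : ∀ j, LowerSemicontinuous (g j))
    (hf0 : ∀ i x, 0 ≤ f i x) (hgε : ∀ j x, ε ≤ g j x)
    (hfM : ∀ i x, f i x ≤ M) (hgM : ∀ j x, g j x ≤ M) (hR : ∀ i x, f i x ≠ 0 → ‖x‖ ≤ R)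
    (hfs : ∀ i, 0 < volume (Function.support (f i)))
    (hyp : ∀ x, ∏ i, f i (U i x) ^ c i ≤ ∏ j, g j (V j x) ^ d j) :
    ∏ i, heatFlow (f i) 1 0 ^ c i ≤ ∏ j, heatFlow (g j) 1 0 ^ d j := by
  have hg0 : ∀ j x, 0 < g j x := fun j x => hε.trans_le (hgε j x)
  have hfm : ∀ i, Measurable (f i) := fun i => (hf i).measurable
  have hgm : ∀ j, Measurable (g j) := fun j => (hg j).measurable
  have hgs : ∀ j, 0 < volume (Function.support (g j)) := fun j => by
    rw [Function.support_eq_univ fun x => (hg0 j x).ne']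
    exact Measure.measure_univ_pos.2 (NeZero.ne _)
  have hfp : ∀ {t : ℝ} {x : H}, 0 < t → ∀ i, 0 < heatFlow (f i) t (U i x) := fun ht i =>
    heatFlow_pos (hfm i) (hf0 i) (hfM i) (hfs i) ht _
  have hgp : ∀ {t : ℝ} {x : H}, 0 < t → ∀ j, 0 < heatFlow (g j) t (V j x) := fun ht j =>
    heatFlow_pos (hgm j) (fun x => (hg0 j x).le) (hgM j) (hgs j) ht _
  by_contra! hlt
  set N := ∏ i, heatFlow (f i) 1 0 ^ c i
  set P := ∏ j, heatFlow (g j) 1 0 ^ d j with hPdef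
  have hP : 0 < P := Finset.prod_pos fun j _ => Real.rpow_pos_of_pos (by
    simpa using hgp (x := 0) one_pos j) _
  have hNP : 1 < N / P := (one_lt_div hP).2 hlt
  set δ := Real.log (N / P) / 2 with hδdef
  have hδ : 0 < δ := half_pos (Real.log_pos hNP)
  set W := heatRatio c d U V f g δ
  have hW1 : 1 < W (1, 0) := by
    have : W (1, 0) = Real.exp δ := by
      simp only [W, heatRatio, map_zero]
      rw [prod_rpow_neg fun j => heatFlow_nonneg (fun x => (hg0 j x).le) _ _, ← div_eq_mul_inv]
      change Real.exp (-(δ * 1)) * (N / P) = Real.exp δ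
      rw [← Real.exp_log (zero_lt_one.trans hNP), ← Real.exp_add]
      congr 1
      rw [hδdef]
      ring
    rw [this]
    exact Real.one_lt_exp_iff.2 hδ
  obtain ⟨ρ, hρ⟩ := exists_heatRatio_le_one_of_le_norm (δ := δ) hc hd hinj hε hfm hgm hf0 hgε hfM
    hgM hR hδ.le
  have h00 : (0 : ℝ) ∈ Set.Icc (0 : ℝ) 1 := ⟨le_rfl, zero_le_one⟩
  have h01 : (1 : ℝ) ∈ Set.Icc (0 : ℝ) 1 := ⟨zero_le_one, le_rfl⟩
  have hρ0 : 0 < ρ := by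
    by_contra! h
    exact absurd (hρ 1 0 zero_le_one le_rfl (by simpa using h)) (not_le.2 hW1)
  obtain ⟨⟨t, x⟩, ⟨ht, hx⟩, hmax⟩ := UpperSemicontinuousOn.exists_isMaxOn
    (s := Set.Icc (0 : ℝ) 1 ×ˢ Metric.closedBall (0 : H) ρ) (f := W)
    ⟨(0, 0), h00, by simpa using hρ0.le⟩
    (isCompact_Icc.prod (isCompact_closedBall _ _))
    ((upperSemicontinuous_heatRatio hc hd hε hf hg hf0 hgε hfM hgM δ).upperSemicontinuousOn _)
  have hWtx : 1 < W (t, x) := hW1.trans_le (hmax ⟨h01, by simpa using hρ0.le⟩)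
  have ht0 : 0 < t := by
    refine lt_of_le_of_ne ht.1 fun h => absurd hWtx (not_lt.2 ?_)
    rw [← h]
    exact heatRatio_zero_le_one hU hV hfr hf0 hg0 hyp δ x
  have hxρ : ‖x‖ < ρ := by
    by_contra! h
    exact absurd (hρ t x ht.1 ht.2 h) (not_le.2 hWtx)
  have hlog : ∀ {s : ℝ} {y : H}, 0 < s → s ≤ 1 → ‖y‖ ≤ ρ →
      logRatio c d U V f g δ s y ≤ logRatio c d U V f g δ t x := fun {s y} hs hs1 hy => by
    rw [← log_heatRatio (hfp hs) (hgp hs), ← log_heatRatio (hfp ht0) (hgp ht0)]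
    exact Real.log_le_log (heatRatio_pos (hfp hs) (hgp hs))
      (hmax (show (s, y) ∈ _ from ⟨⟨hs.le, hs1⟩, by simpa using hy⟩))
  refine not_isLocalMax_logRatio hd hU hV hsurj hfr hfm hgm hf0 (fun j x => (hg0 j x).le) hfM hgM
    hfs hgs hδ ht0 (x := x) ?_ ?_
  · filter_upwards [Ioo_mem_nhdsLT ht0] with s hs
    exact hlog hs.1 (hs.2.le.trans ht.2) hxρ.le
  · filter_upwards [(continuous_norm.tendsto x).eventually (gt_mem_nhds hxρ)] with y hy
    exact hlog ht0 ht.2 hy.le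

end Comparison

section Approximation

/-- An inequality that holds for semicontinuous majorants extends to measurable functions with
finite integrals. -/
lemma le_prod_lintegral_of_forall_lowerSemicontinuous_of_ne_top {X κ : Type*} [Fintype κ]
    {F : κ → Type*} [∀ j, TopologicalSpace (F j)] [∀ j, MeasurableSpace (F j)]
    [∀ j, BorelSpace (F j)] {ν : ∀ j, Measure (F j)} [∀ j, IsFiniteMeasure (ν j)]
    [∀ j, (ν j).WeaklyRegular] {d : κ → ℝ} (hd : ∀ j, 0 < d j) {V : ∀ j, X → F j}
    {φ : X → ℝ≥0} {K : ℝ≥0} (hK : ∀ x, φ x ≤ K) {I : ℝ≥0∞}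
    (hlsc : ∀ (g : ∀ j, F j → ℝ≥0) (ε N : ℝ≥0), 0 < ε → (∀ j, LowerSemicontinuous (g j)) →
      (∀ j y, ε ≤ g j y) → (∀ j y, g j y ≤ N) → (∀ x, φ x ≤ ∏ j, g j (V j x) ^ d j) →
      I ≤ ∏ j, (∫⁻ y, g j y ∂ν j) ^ d j)
    {g : ∀ j, F j → ℝ≥0} (hg : ∀ j, Measurable (g j))
    (hfin : ∀ j, ∫⁻ y, g j y ∂ν j ≠ ∞) (hyp : ∀ x, φ x ≤ ∏ j, g j (V j x) ^ d j) :
    I ≤ ∏ j, (∫⁻ y, g j y ∂ν j) ^ d j := by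
  classical
  have key : ∀ ε : ℝ≥0, 0 < ε → ε ≤ 1 →
      I ≤ ∏ j, (∫⁻ y, g j y ∂ν j + ε + ε * ν j Set.univ) ^ d j := by
    intro ε hε hε1
    choose h hgh hhl hhi using fun j => exists_le_lowerSemicontinuous_lintegral_ge (μ := ν j)
      (fun y => (g j y : ℝ≥0∞)) (hg j).coe_nnreal_ennreal (ENNReal.coe_pos.2 hε).ne'
    set P : ℝ≥0 := ∏ j, ε ^ d j with hP
    have hP0 : 0 < P := Finset.prod_pos fun j _ => NNReal.rpow_pos hε
    have hN : ∀ᶠ N : ℝ≥0 in atTop, ∀ j, K ≤ N ^ d j * P := by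
      refine eventually_all.2 fun j => ?_
      filter_upwards [(NNReal.tendsto_rpow_atTop (hd j)).eventually_ge_atTop (K / P)] with N hN
      rwa [div_le_iff₀ hP0] at hN
    obtain ⟨N, hN, hN1⟩ := (hN.and (eventually_ge_atTop 1)).exists
    set g' : ∀ j, F j → ℝ≥0 := fun j y => (min (h j y + ε) N).toNNReal with hg'
    have hcoe : ∀ j y, (g' j y : ℝ≥0∞) = min (h j y + ε) N := fun j y =>
      ENNReal.coe_toNNReal (ne_top_of_le_ne_top ENNReal.coe_ne_top (min_le_right _ _))
    have hεg : ∀ j y, ε ≤ g' j y := fun j y => by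
      rw [← ENNReal.coe_le_coe, hcoe]
      exact le_min le_add_self (ENNReal.coe_le_coe.2 (hε1.trans hN1))
    refine (hlsc g' ε N hε (fun j => ?_) hεg (fun j y => ?_) fun x => ?_).trans ?_
    · intro y r hr
      have hr' : (r : ℝ≥0∞) < min (h j y + ε) N := by
        rw [← hcoe]; exact ENNReal.coe_lt_coe.2 hr
      have hl : LowerSemicontinuous fun y => min (h j y + ε) (N : ℝ≥0∞) :=
        Continuous.comp_lowerSemicontinuous
          (g := fun r : ℝ≥0∞ => min (r + ε) (N : ℝ≥0∞)) (by fun_prop) (hhl j)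
          fun a b hab => min_le_min_right _ (by gcongr)
      filter_upwards [hl y _ hr'] with z hz
      rw [← hcoe] at hz
      exact ENNReal.coe_lt_coe.1 hz
    · rw [← ENNReal.coe_le_coe, hcoe]
      exact min_le_right _ _
    · by_cases hx : ∀ j, h j (V j x) + ε ≤ N
      · refine (hyp x).trans (Finset.prod_le_prod' fun j _ => ?_)
        refine NNReal.rpow_le_rpow ?_ (hd j).le
        rw [← ENNReal.coe_le_coe, hcoe, min_eq_left (hx j)]
        exact (hgh j _).trans le_self_add
      · push Not at hx
        obtain ⟨a, ha⟩ := hx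
        have haN : g' a (V a x) = N := by
          rw [← ENNReal.coe_inj, hcoe, min_eq_right ha.le]
        calc φ x ≤ K := hK x
          _ ≤ N ^ d a * P := hN a
          _ = N ^ d a * (ε ^ d a * ∏ j ∈ Finset.univ.erase a, ε ^ d j) := by
            rw [Finset.mul_prod_erase _ (fun j => ε ^ d j) (Finset.mem_univ a)]
          _ ≤ g' a (V a x) ^ d a *
              (1 * ∏ j ∈ Finset.univ.erase a, g' j (V j x) ^ d j) := by
            rw [haN]
            gcongr with j
            · exact NNReal.rpow_le_one hε1 (hd a).le
            · exact (hd j).le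
            · exact hεg j _
          _ = _ := by
            rw [one_mul, Finset.mul_prod_erase _ (fun j => g' j (V j x) ^ d j)
              (Finset.mem_univ a)]
    · refine Finset.prod_le_prod' fun j _ => ENNReal.rpow_le_rpow ?_ (hd j).le
      calc ∫⁻ y, g' j y ∂ν j ≤ ∫⁻ y, (h j y + ε) ∂ν j :=
            lintegral_mono fun y => by rw [hcoe]; exact min_le_left _ _
        _ = ∫⁻ y, h j y ∂ν j + ε * ν j Set.univ := by
            rw [lintegral_add_right _ measurable_const, lintegral_const]
        _ ≤ _ := by gcongr; exact hhi j
  have hlim : Tendsto (fun ε : ℝ≥0 => ∏ j, (∫⁻ y, g j y ∂ν j + ε + ε * ν j Set.univ) ^ d j)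
      (𝓝[>] 0) (𝓝 (∏ j, (∫⁻ y, g j y ∂ν j) ^ d j)) := by
    refine ENNReal.tendsto_finsetProd_of_ne_top _ (fun j _ => ?_) fun j _ =>
      ENNReal.rpow_ne_top_of_nonneg (hd j).le (hfin j)
    refine (ENNReal.continuous_rpow_const.tendsto _).comp (tendsto_nhdsWithin_of_tendsto_nhds ?_)
    have h0 : Tendsto (fun ε : ℝ≥0 => (ε : ℝ≥0∞)) (𝓝 0) (𝓝 0) :=
      ENNReal.continuous_coe.tendsto 0
    have h1 := ENNReal.Tendsto.mul_const (b := ν j Set.univ) h0 (Or.inr (measure_ne_top _ _))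
    simpa using (h0.const_add (∫⁻ y, g j y ∂ν j)).add h1
  refine ge_of_tendsto hlim ?_
  filter_upwards [self_mem_nhdsWithin, nhdsWithin_le_nhds (Iic_mem_nhds one_pos)] with ε h0 h1
  exact key ε h0 h1

lemma le_prod_lintegral_of_forall_lowerSemicontinuous {X κ : Type*} [Fintype κ]
    {F : κ → Type*} [∀ j, TopologicalSpace (F j)] [∀ j, MeasurableSpace (F j)]
    [∀ j, BorelSpace (F j)] {ν : ∀ j, Measure (F j)} [∀ j, IsFiniteMeasure (ν j)]
    [∀ j, (ν j).WeaklyRegular] {d : κ → ℝ} (hd : ∀ j, 0 < d j) {V : ∀ j, X → F j}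
    {φ : X → ℝ≥0} {K : ℝ≥0} (hK : ∀ x, φ x ≤ K) {I : ℝ≥0∞}
    (hlsc : ∀ (g : ∀ j, F j → ℝ≥0) (ε N : ℝ≥0), 0 < ε → (∀ j, LowerSemicontinuous (g j)) →
      (∀ j y, ε ≤ g j y) → (∀ j y, g j y ≤ N) → (∀ x, φ x ≤ ∏ j, g j (V j x) ^ d j) →
      I ≤ ∏ j, (∫⁻ y, g j y ∂ν j) ^ d j)
    {g : ∀ j, F j → ℝ≥0} (hg : ∀ j, Measurable (g j))
    (hyp : ∀ x, φ x ≤ ∏ j, g j (V j x) ^ d j) :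
    I ≤ ∏ j, (∫⁻ y, g j y ∂ν j) ^ d j := by
  classical
  by_cases h0 : ∃ a, ∫⁻ y, g a y ∂ν a = 0
  · obtain ⟨a, ha⟩ := h0
    obtain ⟨N, hN⟩ :=
      ((NNReal.tendsto_rpow_atTop (hd a)).eventually_ge_atTop K).exists
    have hae : ∀ᵐ y ∂ν a, g a y = 0 := by
      filter_upwards [(lintegral_eq_zero_iff (hg a).coe_nnreal_ennreal).1 ha] with y hy
      simpa using hy
    set h : ∀ j, F j → ℝ≥0 := fun j y => if j = a then (if g j y = 0 then 0 else N) else 1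
      with hh
    have hha : ∫⁻ y, h a y ∂ν a = 0 := by
      rw [lintegral_eq_zero_iff']
      · filter_upwards [hae] with y hy
        simp [hh, hy]
      · exact AEMeasurable.congr (f := fun _ => 0) aemeasurable_const
          (hae.mono fun y hy => by simp [hh, hy])
    have hle := le_prod_lintegral_of_forall_lowerSemicontinuous_of_ne_top hd hK hlsc (g := h)
      (fun j => ?_) (fun j => ?_) fun x => ?_
    · rw [Finset.prod_eq_zero (Finset.mem_univ a)
        (by rw [hha, ENNReal.zero_rpow_of_pos (hd a)])] at hle
      exact hle.trans zero_le
    · by_cases hj : j = a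
      · simp only [hh, hj, if_true]
        exact Measurable.ite (hg j (measurableSet_singleton 0)) measurable_const measurable_const
      · simp only [hh, hj, if_false]
        exact measurable_const
    · by_cases hj : j = a
      · subst hj
        rw [hha]
        exact ENNReal.zero_ne_top
      · simp [hh, hj]
    · by_cases hx : g a (V a x) = 0
      · refine (hyp x).trans ?_
        rw [Finset.prod_eq_zero (Finset.mem_univ a)
          (by rw [hx, NNReal.zero_rpow (hd a).ne'])]
        exact zero_le
      · rw [Finset.prod_eq_single a (fun j _ hj => by simp [hh, hj]) (by simp)]
        simpa [hh, hx] using (hK x).trans hN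
  · push Not at h0
    by_cases hfin : ∀ j, ∫⁻ y, g j y ∂ν j ≠ ∞
    · exact le_prod_lintegral_of_forall_lowerSemicontinuous_of_ne_top hd hK hlsc hg hfin hyp
    · push Not at hfin
      obtain ⟨a, ha⟩ := hfin
      have : ∏ j, (∫⁻ y, g j y ∂ν j) ^ d j = ∞ := by
        rw [← Finset.mul_prod_erase _ _ (Finset.mem_univ a), ha,
          ENNReal.top_rpow_of_pos (hd a), ENNReal.top_mul]
        exact Finset.prod_ne_zero_iff.2 fun j _ hj =>
          h0 j ((ENNReal.rpow_eq_zero_iff_of_pos (hd j)).1 hj)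
      rw [this]
      exact le_top

lemma exists_upperSemicontinuous_lt_lintegral {G : Type*} [NormedAddCommGroup G]
    [MeasurableSpace G] [BorelSpace G] {μ : Measure G} [IsFiniteMeasure μ]
    {f : G → ℝ≥0} (hf : Measurable f) {r : ℝ≥0∞} (hr : r < ∫⁻ x, f x ∂μ) :
    ∃ (u : G → ℝ≥0) (n : ℕ), u ≤ f ∧ UpperSemicontinuous u ∧ (∀ x, u x ≤ n) ∧
      (∀ x, u x ≠ 0 → ‖x‖ ≤ n) ∧ r < ∫⁻ x, u x ∂μ := by
  set v : ℕ → G → ℝ≥0 := fun n x => if ‖x‖ ≤ n then min (f x) n else 0 with hv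
  have hvm : ∀ n, Measurable (v n) := fun n =>
    Measurable.ite (measurableSet_le measurable_norm measurable_const)
      (hf.min measurable_const) measurable_const
  have hvn : ∀ n x, v n x ≤ n := fun n x => by
    simp only [hv]; split_ifs <;> simp
  have hvf : ∀ n x, v n x ≤ f x := fun n x => by
    simp only [hv]; split_ifs <;> simp
  have hlim : Tendsto (fun n => ∫⁻ x, v n x ∂μ) atTop (𝓝 (∫⁻ x, f x ∂μ)) := by
    refine lintegral_tendsto_of_tendsto_of_monotone
      (fun n => (hvm n).coe_nnreal_ennreal.aemeasurable) (ae_of_all _ fun x n m hnm => ?_)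
      (ae_of_all _ fun x => ?_)
    · refine ENNReal.coe_le_coe.2 ?_
      have hnm' : (n : ℝ) ≤ m := by exact_mod_cast hnm
      simp only [hv]
      by_cases hx : ‖x‖ ≤ n
      · rw [if_pos hx, if_pos (hx.trans hnm')]
        exact min_le_min_left _ (by exact_mod_cast hnm)
      · rw [if_neg hx]
        exact zero_le
    · refine tendsto_const_nhds.congr' ?_
      filter_upwards [tendsto_natCast_atTop_atTop.eventually_ge_atTop ‖x‖,
        tendsto_natCast_atTop_atTop.eventually_ge_atTop (f x)] with n h1 h2
      simp only [hv, if_pos h1, min_eq_left h2]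
  obtain ⟨n, hn⟩ := ((tendsto_order.1 hlim).1 r hr).exists
  have hvfin : ∫⁻ x, v n x ∂μ ≠ ∞ :=
    ((lintegral_mono fun x => ENNReal.coe_le_coe.2 (hvn n x)).trans_lt
      (by simpa using ENNReal.mul_lt_top (by simp) (measure_lt_top μ _))).ne
  obtain ⟨δ, hδ0, hδ⟩ : ∃ δ : ℝ≥0∞, δ ≠ 0 ∧ r + δ < ∫⁻ x, v n x ∂μ := by
    obtain ⟨δ, h0, h1⟩ := ENNReal.lt_iff_exists_add_pos_lt.1 hn
    exact ⟨δ, by simpa using h0.ne', h1⟩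
  obtain ⟨u, huv, hu, hui⟩ := exists_upperSemicontinuous_le_lintegral_le (v n) hvfin hδ0
  refine ⟨u, n, fun x => (huv x).trans (hvf n x), hu, fun x => (huv x).trans (hvn n x),
    fun x hx => ?_, ?_⟩
  · by_contra hxn
    have := huv x
    simp only [hv, if_neg hxn] at this
    exact hx (le_antisymm this zero_le)
  · have hδ' : δ ≠ ∞ := fun h => by simp [h] at hδ
    exact (ENNReal.add_lt_add_iff_right hδ').1 (hδ.trans_le hui)

lemma tendsto_finset_prod_of_ne_zero {α ι : Type*} {l : Filter α} (s : Finset ι)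
    {F : ι → α → ℝ≥0∞} {a : ι → ℝ≥0∞} (ha : ∀ i ∈ s, a i ≠ 0)
    (h : ∀ i ∈ s, Tendsto (F i) l (𝓝 (a i))) :
    Tendsto (fun x => ∏ i ∈ s, F i x) l (𝓝 (∏ i ∈ s, a i)) := by
  classical
  induction s using Finset.induction_on with
  | empty => simpa using tendsto_const_nhds
  | insert i s hi ih =>
    simp only [Finset.prod_insert hi]
    refine ENNReal.Tendsto.mul (h i (Finset.mem_insert_self _ _))
      (Or.inl (ha i (Finset.mem_insert_self _ _)))
      (ih (fun j hj => ha j (Finset.mem_insert_of_mem hj))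
        fun j hj => h j (Finset.mem_insert_of_mem hj)) (Or.inl ?_)
    exact Finset.prod_ne_zero_iff.2 fun j hj => ha j (Finset.mem_insert_of_mem hj)

lemma prod_lintegral_le_of_forall_upperSemicontinuous {ι : Type*} [Fintype ι]
    {E : ι → Type*} [∀ i, NormedAddCommGroup (E i)] [∀ i, MeasurableSpace (E i)]
    [∀ i, BorelSpace (E i)] {μ : ∀ i, Measure (E i)} [∀ i, IsFiniteMeasure (μ i)]
    {c : ι → ℝ} (hc : ∀ i, 0 < c i) {J : ℝ≥0∞} {f : ∀ i, E i → ℝ≥0}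
    (husc : ∀ (u : ∀ i, E i → ℝ≥0) (n : ℕ), (∀ i, UpperSemicontinuous (u i)) →
      (∀ i x, u i x ≤ n) → (∀ i x, u i x ≠ 0 → ‖x‖ ≤ n) → (∀ i, u i ≤ f i) →
      ∏ i, (∫⁻ x, u i x ∂μ i) ^ c i ≤ J)
    (hf : ∀ i, Measurable (f i)) :
    ∏ i, (∫⁻ x, f i x ∂μ i) ^ c i ≤ J := by
  classical
  by_cases h0 : ∃ i, ∫⁻ x, f i x ∂μ i = 0
  · obtain ⟨i, hi⟩ := h0
    rw [Finset.prod_eq_zero (Finset.mem_univ i)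
      (by rw [hi, ENNReal.zero_rpow_of_pos (hc i)])]
    exact zero_le
  push Not at h0
  have : ∀ i, (𝓝[<] (∫⁻ x, f i x ∂μ i)).NeBot := fun i =>
    nhdsLT_neBot_of_exists_lt ⟨0, pos_iff_ne_zero.2 (h0 i)⟩
  have hlim : Tendsto (fun r : ι → ℝ≥0∞ => ∏ i, r i ^ c i)
      (Filter.pi fun i => 𝓝[<] (∫⁻ x, f i x ∂μ i)) (𝓝 (∏ i, (∫⁻ x, f i x ∂μ i) ^ c i)) := by
    refine tendsto_finset_prod_of_ne_zero _ (fun i _ hi =>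
      h0 i ((ENNReal.rpow_eq_zero_iff_of_pos (hc i)).1 hi)) fun i _ => ?_
    exact (ENNReal.continuous_rpow_const.tendsto _).comp
      (tendsto_nhds_of_tendsto_nhdsWithin (tendsto_eval_pi _ i))
  refine le_of_tendsto hlim ?_
  have hev : ∀ᶠ r in Filter.pi fun i => 𝓝[<] (∫⁻ x, f i x ∂μ i),
      ∀ i, r i < ∫⁻ x, f i x ∂μ i :=
    eventually_all.2 fun i => (tendsto_eval_pi _ i).eventually self_mem_nhdsWithin
  filter_upwards [hev] with r hr
  choose u n huf hu hun hus hru using fun i =>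
    exists_upperSemicontinuous_lt_lintegral (hf i) (hr i)
  have hn : ∀ i, n i ≤ ∑ i, n i := fun i =>
    Finset.single_le_sum (fun _ _ => Nat.zero_le _) (Finset.mem_univ i)
  refine (Finset.prod_le_prod' fun i _ => ENNReal.rpow_le_rpow (hru i).le (hc i).le).trans
    (husc u (∑ i, n i) hu (fun i x => (hun i x).trans (by exact_mod_cast hn i))
      (fun i x hx => (hus i x hx).trans (by exact_mod_cast hn i)) huf)

end Approximation

section Gaussian

/-- The gaussian measure with density `exp (-‖x‖ ^ 2 / 2)`, without normalization. -/
def gaussianWeight (G : Type*) [NormedAddCommGroup G] [InnerProductSpace ℝ G]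
    [FiniteDimensional ℝ G] [MeasurableSpace G] [BorelSpace G] : Measure G :=
  volume.withDensity fun x => ENNReal.ofReal (Real.exp (-‖x‖ ^ 2 / 2))

variable {G : Type*} [NormedAddCommGroup G] [InnerProductSpace ℝ G] [FiniteDimensional ℝ G]
  [MeasurableSpace G] [BorelSpace G]

instance isFiniteMeasure_gaussianWeight : IsFiniteMeasure (gaussianWeight G) :=
  isFiniteMeasure_withDensity_ofReal integrable_exp_neg_sq_norm_half.2

lemma lintegral_gaussianWeight {f : G → ℝ≥0} (hf : Measurable f) :
    ∫⁻ x, f x ∂gaussianWeight G = ∫⁻ x, f x * ENNReal.ofReal (Real.exp (-‖x‖ ^ 2 / 2)) := by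
  rw [gaussianWeight, lintegral_withDensity_eq_lintegral_mul _ (by fun_prop)
    hf.coe_nnreal_ennreal]
  simp only [Pi.mul_apply, mul_comm]

lemma lintegral_gaussianWeight_eq_heatFlow {f : G → ℝ≥0} (hf : Measurable f) {M : ℝ≥0}
    (hM : ∀ x, f x ≤ M) :
    ∫⁻ x, f x ∂gaussianWeight G = ENNReal.ofReal (heatFlow (fun x => (f x : ℝ)) 1 0) := by
  have hInt := integrable_heatFlow (M := M) hf.coe_nnreal_real (fun x => (f x).2)
    (fun x => NNReal.coe_le_coe.2 (hM x)) 1 0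
  rw [lintegral_gaussianWeight hf, heatFlow, ofReal_integral_eq_lintegral_ofReal hInt
    (ae_of_all _ fun x => mul_nonneg (NNReal.coe_nonneg _) (Real.exp_pos _).le)]
  refine lintegral_congr fun x => ?_
  rw [ENNReal.ofReal_mul (NNReal.coe_nonneg _)]
  simp

lemma lintegral_mul_exp_gaussianWeight {f : G → ℝ≥0} (hf : Measurable f) :
    ∫⁻ x, ((f x * (Real.exp (‖x‖ ^ 2 / 2)).toNNReal : ℝ≥0) : ℝ≥0∞) ∂gaussianWeight G =
      ∫⁻ x, f x := by
  have hm : Measurable fun x => f x * (Real.exp (‖x‖ ^ 2 / 2)).toNNReal :=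
    hf.mul (by fun_prop)
  rw [lintegral_gaussianWeight hm]
  refine lintegral_congr fun x => ?_
  rw [ENNReal.coe_mul, mul_assoc]
  change _ * (ENNReal.ofReal _ * _) = _
  rw [← ENNReal.ofReal_mul (Real.exp_pos _).le, ← Real.exp_add, neg_div, add_neg_cancel]
  simp

lemma prod_mul_exp_rpow {ι : Type*} [Fintype ι] (a : ι → ℝ≥0) (s c : ι → ℝ) :
    ∏ i, (a i * (Real.exp (s i / 2)).toNNReal) ^ c i =
      (∏ i, a i ^ c i) * (Real.exp ((∑ i, c i * s i) / 2)).toNNReal := by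
  simp only [NNReal.mul_rpow, Finset.prod_mul_distrib]
  congr 1
  rw [← NNReal.coe_inj, NNReal.coe_prod, Real.coe_toNNReal _ (Real.exp_pos _).le,
    Finset.sum_div, Real.exp_sum]
  refine Finset.prod_congr rfl fun i _ => ?_
  rw [NNReal.coe_rpow, Real.coe_toNNReal _ (Real.exp_pos _).le, ← Real.exp_mul]
  congr 1
  ring

end Gaussian

section Main

variable {ι κ : Type*} [Fintype ι] [Fintype κ] {H : Type*} [NormedAddCommGroup H]
  [InnerProductSpace ℝ H] [FiniteDimensional ℝ H]
  {E : ι → Type*} {F : κ → Type*}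
  [∀ i, NormedAddCommGroup (E i)] [∀ i, InnerProductSpace ℝ (E i)]
  [∀ i, FiniteDimensional ℝ (E i)]
  [∀ i, MeasurableSpace (E i)] [∀ i, BorelSpace (E i)]
  [∀ j, NormedAddCommGroup (F j)] [∀ j, InnerProductSpace ℝ (F j)]
  [∀ j, FiniteDimensional ℝ (F j)]
  [∀ j, MeasurableSpace (F j)] [∀ j, BorelSpace (F j)]
  {c : ι → ℝ} {d : κ → ℝ}
  {U : ∀ i, H →ₗ[ℝ] E i} {V : ∀ j, H →ₗ[ℝ] F j}

lemma prod_lintegral_gaussianWeight_le_of_semicontinuous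
    (hc : ∀ i, 0 < c i) (hd : ∀ j, 0 < d j)
    (hU : ∀ i, U i ∘ₗ LinearMap.adjoint (U i) = LinearMap.id)
    (hV : ∀ j, V j ∘ₗ LinearMap.adjoint (V j) = LinearMap.id)
    (hinj : ∀ x, (∀ i, U i x = 0) → x = 0)
    (hsurj : ∀ p : ∀ i, E i, ∃ z, ∀ i, U i z = p i)
    (hfr : ∀ z, ∑ i, c i * ‖U i z‖ ^ 2 = ∑ j, d j * ‖V j z‖ ^ 2)
    {f : ∀ i, E i → ℝ≥0} {g : ∀ j, F j → ℝ≥0} {ε M N : ℝ≥0} {R : ℝ} (hε : 0 < ε)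
    (hf : ∀ i, UpperSemicontinuous (f i)) (hg : ∀ j, LowerSemicontinuous (g j))
    (hgε : ∀ j x, ε ≤ g j x) (hfM : ∀ i x, f i x ≤ M) (hgN : ∀ j x, g j x ≤ N)
    (hR : ∀ i x, f i x ≠ 0 → ‖x‖ ≤ R)
    (hyp : ∀ x, ∏ i, f i (U i x) ^ c i ≤ ∏ j, g j (V j x) ^ d j) :
    ∏ i, (∫⁻ x, f i x ∂gaussianWeight (E i)) ^ c i ≤
      ∏ j, (∫⁻ y, g j y ∂gaussianWeight (F j)) ^ d j := by
  have hfm : ∀ i, Measurable (f i) := fun i => (hf i).measurable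
  have hgm : ∀ j, Measurable (g j) := fun j => (hg j).measurable
  by_cases hfs : ∀ i, 0 < volume (Function.support fun x => (f i x : ℝ))
  · have h := prod_heatFlow_le_of_semicontinuous (c := c) (d := d) (U := U) (V := V)
      (f := fun i x => (f i x : ℝ)) (g := fun j y => (g j y : ℝ)) (ε := ε) (M := max M N) (R := R)
      hc hd hU hV hinj hsurj hfr (NNReal.coe_pos.2 hε)
      (fun i => Continuous.comp_upperSemicontinuous NNReal.continuous_coe (hf i)
        NNReal.coe_mono)
      (fun j => Continuous.comp_lowerSemicontinuous NNReal.continuous_coe (hg j)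
        NNReal.coe_mono)
      (fun i x => NNReal.coe_nonneg _) (fun j x => NNReal.coe_le_coe.2 (hgε j x))
      (fun i x => le_max_of_le_left (NNReal.coe_le_coe.2 (hfM i x)))
      (fun j x => le_max_of_le_right (NNReal.coe_le_coe.2 (hgN j x)))
      (fun i x hx => hR i x (NNReal.coe_ne_zero.1 hx)) hfs
      (fun x => by exact_mod_cast hyp x)
    simp only [lintegral_gaussianWeight_eq_heatFlow (hfm _) (hfM _),
      lintegral_gaussianWeight_eq_heatFlow (hgm _) (hgN _)]
    have h0 : ∀ i, 0 ≤ heatFlow (fun x => (f i x : ℝ)) 1 0 := fun i =>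
      heatFlow_nonneg (fun x => NNReal.coe_nonneg _) _ _
    have h1 : ∀ j, 0 ≤ heatFlow (fun x => (g j x : ℝ)) 1 0 := fun j =>
      heatFlow_nonneg (fun x => NNReal.coe_nonneg _) _ _
    simp only [ENNReal.ofReal_rpow_of_nonneg (h0 _) (hc _).le,
      ENNReal.ofReal_rpow_of_nonneg (h1 _) (hd _).le]
    rw [← ENNReal.ofReal_prod_of_nonneg fun i _ => Real.rpow_nonneg (h0 i) _,
      ← ENNReal.ofReal_prod_of_nonneg fun j _ => Real.rpow_nonneg (h1 j) _]
    exact ENNReal.ofReal_le_ofReal h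
  · push Not at hfs
    obtain ⟨i, hi⟩ := hfs
    have hz : ∫⁻ x, f i x ∂gaussianWeight (E i) = 0 := by
      rw [lintegral_gaussianWeight (hfm i)]
      refine (lintegral_congr_ae (g := fun _ => 0) ?_).trans lintegral_zero
      filter_upwards [measure_eq_zero_iff_ae_notMem.1 (nonpos_iff_eq_zero.1 hi)] with x hx
      have : f i x = 0 := by simpa using hx
      simp [this]
    rw [Finset.prod_eq_zero (Finset.mem_univ i) (by rw [hz, ENNReal.zero_rpow_of_pos (hc i)])]
    exact zero_le

/-- The geometric forward-reverse Brascamp-Lieb inequality for gaussian measures. -/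
theorem prod_lintegral_gaussianWeight_le
    (hc : ∀ i, 0 < c i) (hd : ∀ j, 0 < d j)
    (hU : ∀ i, U i ∘ₗ LinearMap.adjoint (U i) = LinearMap.id)
    (hV : ∀ j, V j ∘ₗ LinearMap.adjoint (V j) = LinearMap.id)
    (hinj : ∀ x, (∀ i, U i x = 0) → x = 0)
    (hsurj : ∀ p : ∀ i, E i, ∃ z, ∀ i, U i z = p i)
    (hfr : ∀ z, ∑ i, c i * ‖U i z‖ ^ 2 = ∑ j, d j * ‖V j z‖ ^ 2)
    {f : ∀ i, E i → ℝ≥0} {g : ∀ j, F j → ℝ≥0}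
    (hf : ∀ i, Measurable (f i)) (hg : ∀ j, Measurable (g j))
    (hyp : ∀ x, ∏ i, f i (U i x) ^ c i ≤ ∏ j, g j (V j x) ^ d j) :
    ∏ i, (∫⁻ x, f i x ∂gaussianWeight (E i)) ^ c i ≤
      ∏ j, (∫⁻ y, g j y ∂gaussianWeight (F j)) ^ d j := by
  refine prod_lintegral_le_of_forall_upperSemicontinuous hc (fun u n hu hun hus huf => ?_) hf
  refine le_prod_lintegral_of_forall_lowerSemicontinuous hd (V := fun j => V j)
    (φ := fun x => ∏ i, u i (U i x) ^ c i) (K := ∏ i, (n : ℝ≥0) ^ c i)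
    (fun x => Finset.prod_le_prod' fun i _ => NNReal.rpow_le_rpow (hun i _) (hc i).le)
    (fun h ε N hε hh hhε hhN hle => ?_) hg fun x => ?_
  · exact prod_lintegral_gaussianWeight_le_of_semicontinuous hc hd hU hV hinj hsurj hfr hε hu hh
      hhε hun hhN hus hle
  · exact (Finset.prod_le_prod' fun i _ => NNReal.rpow_le_rpow (huf i _) (hc i).le).trans (hyp x)

/-- The geometric forward-reverse Brascamp-Lieb inequality. -/
theorem prod_lintegral_le
    (hc : ∀ i, 0 < c i) (hd : ∀ j, 0 < d j)
    (hU : ∀ i, U i ∘ₗ LinearMap.adjoint (U i) = LinearMap.id)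
    (hV : ∀ j, V j ∘ₗ LinearMap.adjoint (V j) = LinearMap.id)
    (hinj : ∀ x, (∀ i, U i x = 0) → x = 0)
    (hsurj : ∀ p : ∀ i, E i, ∃ z, ∀ i, U i z = p i)
    (hfr : ∀ z, ∑ i, c i * ‖U i z‖ ^ 2 = ∑ j, d j * ‖V j z‖ ^ 2)
    {f : ∀ i, E i → ℝ≥0} {g : ∀ j, F j → ℝ≥0}
    (hf : ∀ i, Measurable (f i)) (hg : ∀ j, Measurable (g j))
    (hyp : ∀ x, ∏ i, f i (U i x) ^ c i ≤ ∏ j, g j (V j x) ^ d j) :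
    ∏ i, (∫⁻ x, (f i x : ℝ≥0∞)) ^ c i ≤ ∏ j, (∫⁻ y, (g j y : ℝ≥0∞)) ^ d j := by
  simp only [← lintegral_mul_exp_gaussianWeight (hf _), ← lintegral_mul_exp_gaussianWeight (hg _)]
  refine prod_lintegral_gaussianWeight_le hc hd hU hV hinj hsurj hfr
    (fun i => (hf i).mul (by fun_prop)) (fun j => (hg j).mul (by fun_prop)) fun x => ?_
  rw [prod_mul_exp_rpow, prod_mul_exp_rpow, hfr]
  exact mul_le_mul_left (hyp x) _

end Main

end

end BrascampLieb

namespace FRBL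

variable {k m : ℕ}
  (E : Fin k → Type*) (F : Fin m → Type*)
  [∀ i, NormedAddCommGroup (E i)] [∀ i, InnerProductSpace ℝ (E i)]
  [∀ i, FiniteDimensional ℝ (E i)]
  [∀ i, MeasurableSpace (E i)] [∀ i, BorelSpace (E i)]
  [∀ j, NormedAddCommGroup (F j)] [∀ j, InnerProductSpace ℝ (F j)]
  [∀ j, FiniteDimensional ℝ (F j)]
  [∀ j, MeasurableSpace (F j)] [∀ j, BorelSpace (F j)]

/-- **Corollary (geometric forward-reverse Brascamp-Lieb inequality, second form).** -/
theorem geometric_FRBL_II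
    (c : Fin k → ℝ) (d : Fin m → ℝ)
    (hc : ∀ i, 0 < c i) (hd : ∀ j, 0 < d j)
    (U : ∀ i, PiLp 2 E →ₗ[ℝ] E i) (V : ∀ j, PiLp 2 E →ₗ[ℝ] F j)
    (hU : ∀ i, (U i) ∘ₗ LinearMap.adjoint (U i) = LinearMap.id)
    (hV : ∀ j, (V j) ∘ₗ LinearMap.adjoint (V j) = LinearMap.id)
    (hbij : Function.Bijective (fun x : PiLp 2 E => ∑ i, singleL E i (U i x)))
    (hframe : (∑ i, c i • (LinearMap.adjoint (U i) ∘ₗ (U i))) =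
      ∑ j, d j • (LinearMap.adjoint (V j) ∘ₗ (V j)))
    (f : ∀ i, E i → ℝ≥0) (g : ∀ j, F j → ℝ≥0)
    (hf : ∀ i, Measurable (f i)) (hg : ∀ j, Measurable (g j))
    (hyp : ∀ x : PiLp 2 E,
      (∏ i, f i (U i x) ^ c i) ≤ ∏ j, g j (V j x) ^ d j) :
    (∏ i, (∫⁻ x, (f i x : ℝ≥0∞)) ^ c i) ≤ ∏ j, (∫⁻ y, (g j y : ℝ≥0∞)) ^ d j := by
  have hcoord : ∀ (p : ∀ i, E i) i, projL E i (∑ l, singleL E l (p l)) = p i := by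
    intro p i
    rw [map_sum, Finset.sum_eq_single i]
    · simp [projL, singleL, toPi]
    · intro l _ hl
      simp [projL, singleL, toPi, Pi.single_eq_of_ne hl.symm]
    · simp
  refine BrascampLieb.prod_lintegral_le hc hd hU hV (fun x hx => hbij.1 ?_) (fun p => ?_)
    (fun z => ?_) hf hg hyp
  · simp [hx]
  · obtain ⟨z, hz⟩ := hbij.2 (∑ l, singleL E l (p l))
    refine ⟨z, fun i => ?_⟩
    rw [← hcoord (fun l => U l z) i, ← hcoord p i]
    exact congrArg _ hz
  · have h := congrArg (fun T : PiLp 2 E →ₗ[ℝ] PiLp 2 E => ⟪T z, z⟫) hframe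
    simpa [LinearMap.sum_apply, sum_inner, real_inner_smul_left, LinearMap.adjoint_inner_left]
      using h

end FRBL
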